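/- arXiv:1806.00702 — 3 statements merged into one kernel-verified Lean document; each statement's English description precedes it below -/
import Mathlib

section
/- Let X be a non-reflexive Banach space. Then for every k ∈ ℕ there exists a map f_k : ([ℕ]^k, d_H) → X with Lip(f_k) ≤ 1 such that diam(f_k([M]^k)) ≥ k/4 for every infinite subset M of ℕ. In particular, inf over infinite M of diam(f_k([M]^k)) tends to infinity as k → ∞. -/
open Finset Filter

/-- The Hamming distance on `[ℕ]^k`. -/
def hammingDistH {k : ℕ} (m n : Fin k → ℕ) : ℕ :=
  (Finset.univ.filter fun i => m i ≠ n i).card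

/-- `f : [ℕ]^k → X` is `L`-Lipschitz for the Hamming metric. -/
def IsLipWith {X : Type*} [NormedAddCommGroup X] {k : ℕ} (L : ℝ) (f : (Fin k → ℕ) → X) : Prop :=
  ∀ m n : Fin k → ℕ, StrictMono m → StrictMono n →
    ‖f m - f n‖ ≤ L * (hammingDistH m n : ℝ)

/-- A Banach space is reflexive if the canonical embedding into its bidual is surjective. -/
def IsReflexiveSpace (X : Type*) [NormedAddCommGroup X] [NormedSpace ℝ X] : Prop :=
  Function.Surjective (NormedSpace.inclusionInDoubleDual ℝ X)

/-- **Goldstine's theorem** for a finite family of functionals: an element of the closed unit ball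
of the bidual is approximated on the family by elements of the closed unit ball of `X`. -/
theorem goldstine_finite {X : Type*} [NormedAddCommGroup X] [NormedSpace ℝ X]
    {ι : Type*} [Finite ι] (F : StrongDual ℝ (StrongDual ℝ X)) (hF : ‖F‖ ≤ 1)
    (φ : ι → StrongDual ℝ X) :
    (fun i => F (φ i)) ∈ closure ((fun x i => φ i x) '' Metric.closedBall (0 : X) 1) := by
  classical
  have := Fintype.ofFinite ι
  by_contra hc
  have hconv : Convex ℝ ((fun x i => φ i x) '' Metric.closedBall (0 : X) 1) :=
    (convex_closedBall (0 : X) 1).linear_image (LinearMap.pi fun i => (φ i).toLinearMap)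
  obtain ⟨l, u, hlu, hul⟩ := geometric_hahn_banach_closed_point hconv.closure isClosed_closure hc
  have hl (d : ι → ℝ) : l d = ∑ i, l (Pi.single i 1) * d i := by
    conv_lhs => rw [pi_eq_sum_univ' d]
    simp [mul_comm]
  set g : StrongDual ℝ X := ∑ i, l (Pi.single i 1) • φ i with hg
  have hgu : ∀ x : X, ‖x‖ ≤ 1 → g x < u := by
    intro x hx
    have := hlu _ (subset_closure ⟨x, by simpa using hx, rfl⟩)
    rw [hl] at this
    simpa [hg] using this
  have hu : 0 ≤ u := by simpa using (hgu 0 (by simp)).le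
  have hgn : ‖g‖ ≤ u := by
    refine ContinuousLinearMap.opNorm_le_of_unit_norm hu fun x hx => ?_
    rw [Real.norm_eq_abs, abs_le]
    have h := hgu (-x) (by simp [hx])
    rw [map_neg] at h
    exact ⟨by linarith, (hgu x hx.le).le⟩
  have hFg : F g = l fun i => F (φ i) := by
    rw [hl, hg]
    simp
  have h1 : F g ≤ ‖F‖ * ‖g‖ := (le_abs_self _).trans (F.le_opNorm g)
  nlinarith [norm_nonneg g]

/-- If `F` in the bidual is at distance more than `r` from the canonical image of `X`, then its
restriction to the annihilator of any finite family of vectors has norm more than `r`. -/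
theorem exists_annihilating_functional {X : Type*} [NormedAddCommGroup X] [NormedSpace ℝ X]
    {ι : Type*} [Finite ι] {F : StrongDual ℝ (StrongDual ℝ X)} {r : ℝ}
    (hF : ∀ x, r < ‖F - NormedSpace.inclusionInDoubleDual ℝ X x‖) (x : ι → X) :
    ∃ φ : StrongDual ℝ X, ‖φ‖ ≤ 1 ∧ (∀ i, φ (x i) = 0) ∧ r < F φ := by
  let J := NormedSpace.inclusionInDoubleDual ℝ X
  let Y : Submodule ℝ (StrongDual ℝ X) := ⨅ i, (J (x i)).toLinearMap.ker
  obtain ⟨G, hG, hGn⟩ := exists_extension_norm_eq Y (F.comp Y.subtypeL)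
  have hspan : (F - G).toLinearMap ∈
      Submodule.span ℝ (Set.range fun i => (J (x i)).toLinearMap) := by
    refine mem_span_of_iInf_ker_le_ker fun φ hφ => ?_
    have := hG ⟨φ, hφ⟩
    simp at this
    simp [this]
  have hrange : ∃ y, J y = F - G := by
    have hle : Submodule.span ℝ (Set.range fun i => (J (x i)).toLinearMap) ≤
        (J.toLinearMap.range).map (ContinuousLinearMap.coeLM ℝ) := by
      rw [Submodule.span_le]
      rintro _ ⟨i, rfl⟩
      exact ⟨J (x i), ⟨x i, rfl⟩, rfl⟩
    obtain ⟨_, ⟨y, rfl⟩, hy⟩ := hle hspan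
    exact ⟨y, ContinuousLinearMap.coe_injective hy⟩
  obtain ⟨y, hy⟩ := hrange
  have hr : r < ‖G‖ := by
    have hFy : F - J y = G := by rw [hy]; exact sub_sub_cancel F G
    exact hFy ▸ hF y
  rw [hGn] at hr
  obtain ⟨⟨φ, hφ⟩, hφ1, hφr⟩ := ContinuousLinearMap.exists_lt_apply_of_lt_opNorm _ hr
  have hφ0 : ∀ i, φ (x i) = 0 := fun i => (Submodule.mem_iInf _).1 hφ i
  have hφ1' : ‖φ‖ ≤ 1 := hφ1.le
  have hφr' : r < |F φ| := hφr
  rcases lt_abs.1 hφr' with h | h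
  · exact ⟨φ, hφ1', hφ0, h⟩
  · exact ⟨-φ, by simpa using hφ1', by simpa using hφ0, by simpa using h⟩

/-- Riesz's lemma for the range of a non-surjective isometric linear map from a Banach space. -/
theorem exists_norm_eq_one_far_from_range {X E : Type*}
    [NormedAddCommGroup X] [NormedSpace ℝ X] [CompleteSpace X]
    [NormedAddCommGroup E] [NormedSpace ℝ E] (J : X →L[ℝ] E)
    (hnorm : ∀ x, ‖J x‖ = ‖x‖) (hJ : ¬ Function.Surjective J) {r : ℝ} (hr : r < 1) :
    ∃ F : E, ‖F‖ = 1 ∧ ∀ x, r < ‖F - J x‖ := by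
  obtain ⟨s, hrs, hs⟩ := exists_between hr
  have hclosed : IsClosed (J.toLinearMap.range : Set E) := by
    rw [LinearMap.coe_range]
    exact (AddMonoidHomClass.isometry_of_norm J hnorm).isUniformInducing.isComplete_range.isClosed
  have hne : ∃ F, F ∉ J.toLinearMap.range := by
    by_contra! h
    exact hJ h
  obtain ⟨F, hF, hFs⟩ := riesz_lemma hclosed hne hs
  have hF0 : F ≠ 0 := fun h => hF (h ▸ Submodule.zero_mem _)
  have hpos : 0 < ‖F‖ := norm_pos_iff.2 hF0
  have hFn : ‖‖F‖⁻¹ • F‖ = 1 := by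
    rw [norm_smul, norm_inv, norm_norm, inv_mul_cancel₀ hpos.ne']
  refine ⟨‖F‖⁻¹ • F, hFn, fun x => hrs.trans_le ?_⟩
  have h := hFs (J (‖F‖ • x)) ⟨_, rfl⟩
  have heq : F - J (‖F‖ • x) = ‖F‖ • (‖F‖⁻¹ • F - J x) := by
    rw [smul_sub, smul_inv_smul₀ hpos.ne', map_smul]
  rw [heq, norm_smul, norm_norm, mul_comm] at h
  exact le_of_mul_le_mul_left h hpos

/-- In a non-reflexive Banach space, the bidual has an element of norm `1` which is at distance
more than `r` from the canonical image of the space, for any `r < 1`. -/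
theorem exists_far_from_inclusionInDoubleDual {X : Type*} [NormedAddCommGroup X] [NormedSpace ℝ X]
    [CompleteSpace X] (hX : ¬ Function.Surjective (NormedSpace.inclusionInDoubleDual ℝ X)) {r : ℝ}
    (hr : r < 1) :
    ∃ F : StrongDual ℝ (StrongDual ℝ X), ‖F‖ = 1 ∧
      ∀ x, r < ‖F - NormedSpace.inclusionInDoubleDual ℝ X x‖ := by
  have hfar := exists_norm_eq_one_far_from_range (X := X) (E := StrongDual ℝ (StrongDual ℝ X))
    (NormedSpace.inclusionInDoubleDual ℝ X) (NormedSpace.inclusionInDoubleDualLi ℝ).norm_map hX hr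
  exact hfar

/-- James' theorem: a non-reflexive Banach space has a sequence in its unit ball, and a sequence of
functionals in the dual unit ball, with a uniformly triangular pairing. -/
theorem exists_james_sequence {X : Type*} [NormedAddCommGroup X] [NormedSpace ℝ X]
    [CompleteSpace X] (hX : ¬ IsReflexiveSpace X) {r : ℝ} (hr : r < 1) :
    ∃ (x : ℕ → X) (φ : ℕ → StrongDual ℝ X), (∀ n, ‖x n‖ ≤ 1) ∧ (∀ n, ‖φ n‖ ≤ 1) ∧
      (∀ m n, m < n → φ n (x m) = 0) ∧ ∀ m n, m ≤ n → r < φ m (x n) := by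
  classical
  obtain ⟨F, hF1, hF⟩ := exists_far_from_inclusionInDoubleDual hX hr
  obtain ⟨f, hf, hfr⟩ := exists_seq_of_forall_finset_exists
    (fun p : X × StrongDual ℝ X => ‖p.1‖ ≤ 1 ∧ ‖p.2‖ ≤ 1 ∧ r < F p.2 ∧ r < p.2 p.1)
    (fun p q => q.2 p.1 = 0 ∧ r < p.2 q.1) (by
      intro s hs
      obtain ⟨φ, hφ1, hφ0, hφr⟩ := exists_annihilating_functional hF fun p : s => p.1.1
      let ψ : Option s → StrongDual ℝ X := fun o => o.elim φ fun p => p.1.2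
      have hψ : ∀ o, r < F (ψ o) := by
        rintro (_ | p)
        · exact hφr
        · exact (hs p.1 p.2).2.2.1
      have hopen : IsOpen {d : Option s → ℝ | ∀ o, r < d o} := by
        simp only [Set.ofPred_forall]
        exact isOpen_iInter_of_finite fun o => isOpen_lt continuous_const (continuous_apply o)
      obtain ⟨_, hd, x, hx, rfl⟩ :=
        mem_closure_iff.1 (goldstine_finite F hF1.le ψ) _ hopen hψ
      refine ⟨(x, φ), ⟨by simpa using hx, hφ1, hφr, hd none⟩, fun p hp => ?_⟩
      exact ⟨hφ0 ⟨p, hp⟩, hd (some ⟨p, hp⟩)⟩)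
  refine ⟨fun n => (f n).1, fun n => (f n).2, fun n => (hf n).1, fun n => (hf n).2.1,
    fun m n h => (hfr m n h).1, fun m n h => ?_⟩
  rcases h.eq_or_lt with rfl | h
  · exact (hf m).2.2.2
  · exact (hfr m n h).2

/-- if `X` is a non-reflexive Banach space, then for every `k` there is a
`1`-Lipschitz map `f_k : ([ℕ]^k, d_H) → X` with `diam f_k([M]^k) ≥ k/4` for every infinite
`M ⊆ ℕ` (hence the infimum over `M` of these diameters tends to `∞` with `k`). -/
theorem statement_4 {X : Type*} [NormedAddCommGroup X] [NormedSpace ℝ X] [CompleteSpace X]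
    (hX : ¬ IsReflexiveSpace X) (k : ℕ) :
    ∃ f : (Fin k → ℕ) → X, IsLipWith 1 f ∧
      ∀ M : Set ℕ, M.Infinite →
        (k : ℝ) / 4 ≤ Metric.diam (f '' {m | StrictMono m ∧ ∀ i, m i ∈ M}) := by
  obtain ⟨x, φ, hx, hφ, hφ0, hφr⟩ := exists_james_sequence hX (r := 1 / 2) (by norm_num)
  refine ⟨fun m => (1 / 2 : ℝ) • ∑ i, x (m i), fun m n _ _ => ?_, fun M hM => ?_⟩
  · have hterm (i : Fin k) : ‖x (m i) - x (n i)‖ ≤ if m i ≠ n i then 2 else 0 := by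
      split_ifs with h
      · linarith [norm_sub_le (x (m i)) (x (n i)), hx (m i), hx (n i)]
      · rw [not_not.1 h]
        simp
    have hsum : ‖∑ i, (x (m i) - x (n i))‖ ≤ 2 * (hammingDistH m n : ℝ) := by
      refine (norm_sum_le_of_le _ fun i _ => hterm i).trans_eq ?_
      rw [← Finset.sum_filter, Finset.sum_const, nsmul_eq_mul, mul_comm, hammingDistH]
    rw [← smul_sub, norm_smul,
      Real.norm_of_nonneg one_half_pos.le]
    rw [Finset.sum_sub_distrib] at hsum
    linarith
  · have hM' : (Set.ofPred (· ∈ M)).Infinite := hM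
    have hmono := Nat.nth_strictMono hM'
    have hmem := Nat.nth_mem_of_infinite hM'
    set e := Nat.nth (· ∈ M)
    have hbdd : Bornology.IsBounded ((fun m : Fin k → ℕ => (1 / 2 : ℝ) • ∑ i, x (m i)) ''
        {m | StrictMono m ∧ ∀ i, m i ∈ M}) := by
      refine isBounded_iff_forall_norm_le.2 ⟨k, ?_⟩
      rintro _ ⟨m, -, rfl⟩
      have : ‖∑ i, x (m i)‖ ≤ k := by
        simpa using norm_sum_le_of_le (Finset.univ : Finset (Fin k)) fun i _ => hx (m i)
      rw [norm_smul]
      norm_num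
      linarith [norm_nonneg (∑ i, x (m i))]
    have hdist := Metric.dist_le_diam_of_mem hbdd
      ⟨fun i => e (k + i), ⟨fun i j h => hmono (by simpa using h), fun i => hmem _⟩, rfl⟩
      ⟨fun i => e i, ⟨fun i j h => hmono (by simpa using h), fun i => hmem _⟩, rfl⟩
    refine le_trans ?_ hdist
    rw [dist_eq_norm, ← smul_sub, norm_smul]
    have hlate : (k : ℝ) / 2 ≤ φ (e k) (∑ i : Fin k, x (e (k + i))) := by
      rw [map_sum]
      have := Finset.card_nsmul_le_sum Finset.univ (fun i : Fin k => φ (e k) (x (e (k + i))))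
        (1 / 2) fun i _ => (hφr _ _ (hmono.monotone (Nat.le_add_right _ _))).le
      simp only [Finset.card_univ, Fintype.card_fin, nsmul_eq_mul] at this
      linarith
    have hearly : φ (e k) (∑ i : Fin k, x (e i)) = 0 := by
      rw [map_sum]
      exact Finset.sum_eq_zero fun i _ => hφ0 _ _ (hmono i.2)
    have hle := (le_abs_self _).trans ((φ (e k)).le_of_opNorm_le (hφ (e k))
      (∑ i : Fin k, x (e (k + i)) - ∑ i : Fin k, x (e i)))
    rw [map_sub, hearly] at hle
    norm_num
    linarith
end

section
/- Let Y be a reflexive asymptotic-c₀ Banach space. If X is a Banach space that coarsely embeds into Y, then X is also reflexive and asymptotic-c₀. -/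
open Finset Filter

/-- A closed subspace of finite codimension. -/
def FinCodimClosed {X : Type*} [NormedAddCommGroup X] [NormedSpace ℝ X]
    (Y : Submodule ℝ X) : Prop :=
  IsClosed (Y : Set X) ∧ FiniteDimensional ℝ (X ⧸ Y)

/-- `(x₁,...,x_k)` is `D`-equivalent to the unit vector basis of `ℓ∞^k`. -/
def EquivLinftyBasis (D : ℝ) {X : Type*} [NormedAddCommGroup X] [NormedSpace ℝ X]
    {k : ℕ} (x : Fin k → X) : Prop :=
  ∃ A B : ℝ, 0 < A ∧ 0 < B ∧ A * B ≤ D ∧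
    ∀ a : Fin k → ℝ,
      (1 / A) * (⨆ i, |a i|) ≤ ‖∑ i, a i • x i‖ ∧ ‖∑ i, a i • x i‖ ≤ B * ⨆ i, |a i|

/-- `X` is `C`-asymptotic-`c₀` (winning strategy for the subspace player). -/
def IsAsymptoticC0With (C : ℝ) (X : Type*) [NormedAddCommGroup X] [NormedSpace ℝ X] : Prop :=
  ∀ k : ℕ, ∀ ε : ℝ, 0 < ε →
    ∃ σ : (Σ i : Fin k, (Fin i.1 → X)) → Submodule ℝ X,
      (∀ p, FinCodimClosed (σ p)) ∧
      ∀ x : Fin k → X,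
        (∀ i : Fin k, ‖x i‖ = 1 ∧ x i ∈ σ ⟨i, fun j => x ⟨j.1, j.2.trans i.2⟩⟩) →
        EquivLinftyBasis (C + ε) x

/-- `X` is asymptotic-`c₀` if it is `C`-asymptotic-`c₀` for some `C ≥ 1`. -/
def AsymptoticC0 (X : Type*) [NormedAddCommGroup X] [NormedSpace ℝ X] : Prop :=
  ∃ C : ℝ, 1 ≤ C ∧ IsAsymptoticC0With C X

/-- `g` is a coarse embedding: `ω_g(t) < ∞` for every `t` and `ρ_g(t) → ∞` as `t → ∞`. -/
def CoarseEmbedding {α β : Type*} [PseudoMetricSpace α] [PseudoMetricSpace β]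
    (g : α → β) : Prop :=
  (∀ t : ℝ, ∃ B : ℝ, ∀ x y : α, dist x y ≤ t → dist (g x) (g y) ≤ B) ∧
  (∀ A : ℝ, ∃ t : ℝ, ∀ x y : α, t ≤ dist x y → A ≤ dist (g x) (g y))

open Topology

section Preliminaries

variable {E : Type*} [NormedAddCommGroup E] [NormedSpace ℝ E]

/-- The neighbourhood filter of `0` in the weak topology. -/
def weakZero (E : Type*) [NormedAddCommGroup E] [NormedSpace ℝ E] : Filter E :=
  ⨅ φ : StrongDual ℝ E, comap φ (𝓝 0)

theorem tendsto_weakZero_iff {I : Type*} {l : Filter I} {d : I → E} :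
    Tendsto d l (weakZero E) ↔ ∀ φ : StrongDual ℝ E, Tendsto (fun n => φ (d n)) l (𝓝 0) := by
  simp [weakZero, tendsto_iInf, tendsto_comap_iff, Function.comp_def]

theorem tendsto_of_le_weakZero {l : Filter E} (h : l ≤ weakZero E) (φ : StrongDual ℝ E) :
    Tendsto φ l (𝓝 0) :=
  tendsto_weakZero_iff.1 (tendsto_id'.2 h) φ

theorem exists_finCodimClosed_of_eventually_weakZero {p : E → Prop}
    (h : ∀ᶠ v in weakZero E, p v) : ∃ Z : Submodule ℝ E, FinCodimClosed Z ∧ ∀ v ∈ Z, p v := by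
  rw [weakZero, Filter.Eventually, Filter.mem_iInf] at h
  obtain ⟨I, hI, V, hV, hVp⟩ := h
  have := hI.fintype
  refine ⟨LinearMap.ker (LinearMap.pi fun i : I => (i.1 : E →ₗ[ℝ] ℝ)), ⟨?_, ?_⟩, ?_⟩
  · have : ((LinearMap.ker (LinearMap.pi fun i : I => (i.1 : E →ₗ[ℝ] ℝ)) : Submodule ℝ E) : Set E)
        = ⋂ i : I, {v | i.1 v = 0} := by
      ext v
      simp [LinearMap.mem_ker, funext_iff]
    rw [this]
    exact isClosed_iInter fun i => isClosed_eq i.1.continuous continuous_const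
  · exact Module.Finite.equiv (LinearMap.quotKerEquivRange _).symm
  · intro v hv
    have : v ∈ ⋂ i, V i := by
      refine Set.mem_iInter.2 fun i => ?_
      obtain ⟨t, ht, hts⟩ := hV i
      apply hts
      have h0 : i.1 v = 0 := congrFun (LinearMap.mem_ker.1 hv) i
      simpa [h0] using mem_of_mem_nhds ht
    rw [← hVp] at this
    exact this

theorem FinCodimClosed.eventually_exists_near {Z : Submodule ℝ E} (hZ : FinCodimClosed Z)
    {η : ℝ} (hη : 0 < η) :
    ∀ᶠ v in weakZero E, ‖v‖ ≤ 1 → ∃ z ∈ Z, ‖z‖ ≤ 1 ∧ ‖v - z‖ ≤ η := by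
  obtain ⟨hZc, hZf⟩ := hZ
  have : IsClosed (Z : Set E) := hZc
  let b := Module.finBasis ℝ (E ⧸ Z)
  let e : (E ⧸ Z) ≃L[ℝ] (Fin (Module.finrank ℝ (E ⧸ Z)) → ℝ) := b.equivFun.toContinuousLinearEquiv
  let q : E →L[ℝ] E ⧸ Z := Z.mkQL
  have hq : Tendsto q (weakZero E) (𝓝 0) := by
    have h1 : Tendsto (fun v => e (q v)) (weakZero E) (𝓝 0) := by
      rw [tendsto_pi_nhds]
      intro i
      exact tendsto_of_le_weakZero le_rfl
        ((ContinuousLinearMap.proj i : _ →L[ℝ] ℝ).comp (e.toContinuousLinearMap.comp q))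
    have h2 := (e.symm.continuous.tendsto 0).comp h1
    simpa [Function.comp_def] using h2
  have hq' : ∀ᶠ v in weakZero E, ‖q v‖ < η / 2 := by
    have := hq.norm
    rw [norm_zero] at this
    exact this.eventually_lt_const (by positivity)
  filter_upwards [hq'] with v hv hv1
  obtain ⟨z, hz, hzv⟩ : ∃ z ∈ Z, ‖v - z‖ < η / 2 := by
    obtain ⟨w, hw, hwn⟩ := Submodule.Quotient.norm_mk_lt (S := Z) (q v) (ε := η / 2 - ‖q v‖) (by linarith)
    refine ⟨v - w, ?_, by simpa using hwn⟩
    rw [← Submodule.Quotient.eq]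
    exact hw.symm
  have hzn : ‖z‖ ≤ 1 + η / 2 := by
    have : ‖z‖ ≤ ‖v‖ + ‖v - z‖ := by
      simpa using norm_sub_le v (v - z)
    linarith
  have hpos : 0 < 1 + η / 2 := by positivity
  refine ⟨(1 + η / 2)⁻¹ • z, Z.smul_mem _ hz, ?_, ?_⟩
  · rw [norm_smul, norm_inv, Real.norm_of_nonneg hpos.le, inv_mul_le_iff₀ hpos]
    linarith
  · have h3 : v - (1 + η / 2)⁻¹ • z = (v - z) + ((η / 2) * (1 + η / 2)⁻¹) • z := by
      have : (η / 2) * (1 + η / 2)⁻¹ = 1 - (1 + η / 2)⁻¹ := by field_simp; ring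
      rw [this, sub_smul, one_smul]; abel
    rw [h3]
    refine (norm_add_le _ _).trans ?_
    rw [norm_smul, Real.norm_of_nonneg (by positivity)]
    have : η / 2 * (1 + η / 2)⁻¹ * ‖z‖ ≤ η / 2 := by
      rw [mul_assoc]
      have : (1 + η / 2)⁻¹ * ‖z‖ ≤ 1 := by
        rw [inv_mul_le_iff₀ hpos]; linarith
      nlinarith
    linarith

/-- Limits of bounded functionals along an ultrafilter exist in the weak-* topology. -/
theorem exists_weakStar_limit {I : Type*} (U : Ultrafilter I) (D : I → StrongDual ℝ E) {c : ℝ}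
    (hD : ∀ᶠ n in U, ‖D n‖ ≤ c) :
    ∃ F : StrongDual ℝ E, ‖F‖ ≤ c ∧ ∀ x, Tendsto (fun n => D n x) U (𝓝 (F x)) := by
  have hK := WeakDual.isCompact_closedBall (𝕜 := ℝ) (0 : StrongDual ℝ E) c
  obtain ⟨F, hF, hlim⟩ := hK.ultrafilter_le_nhds (U.map fun n => StrongDual.toWeakDual (D n)) (by
    rw [le_principal_iff]
    refine Filter.mem_map.2 (mem_of_superset hD fun n hn => ?_)
    simpa using hn)
  refine ⟨WeakDual.toStrongDual F, by simpa using hF, fun x => ?_⟩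
  exact ((WeakDual.eval_continuous x).tendsto F).comp hlim

theorem IsReflexiveSpace.exists_weak_limit (h : IsReflexiveSpace E) {I : Type*} (U : Ultrafilter I)
    (d : I → E) {c : ℝ} (hd : ∀ᶠ n in U, ‖d n‖ ≤ c) :
    ∃ y : E, ∀ φ : StrongDual ℝ E, Tendsto (fun n => φ (d n)) U (𝓝 (φ y)) := by
  obtain ⟨F, -, hF⟩ := exists_weakStar_limit U
    (fun n => NormedSpace.inclusionInDoubleDual ℝ E (d n)) (c := c) (by
      filter_upwards [hd] with n hn
      exact (NormedSpace.double_dual_bound ℝ E _).trans hn)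
  obtain ⟨y, rfl⟩ := h F
  exact ⟨y, hF⟩

theorem norm_le_of_weakStar_tendsto {I : Type*} {l : Filter I} [l.NeBot] {D : I → StrongDual ℝ E}
    {F : StrongDual ℝ E} (hF : ∀ x, Tendsto (fun n => D n x) l (𝓝 (F x))) {c : ℝ}
    (hD : ∀ᶠ n in l, ‖D n‖ ≤ c) : ‖F‖ ≤ c := by
  have hc : 0 ≤ c := by
    obtain ⟨n, hn⟩ := hD.exists
    exact (norm_nonneg _).trans hn
  refine F.opNorm_le_bound hc fun x => ?_
  refine le_of_tendsto (hF x).norm ?_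
  filter_upwards [hD] with n hn
  exact (D n).le_of_opNorm_le hn x

theorem norm_le_of_weak_tendsto {I : Type*} {l : Filter I} [l.NeBot] {d : I → E} {y : E}
    (hy : ∀ φ : StrongDual ℝ E, Tendsto (fun n => φ (d n)) l (𝓝 (φ y))) {c : ℝ}
    (hd : ∀ᶠ n in l, ‖d n‖ ≤ c) : ‖y‖ ≤ c := by
  rw [← (NormedSpace.inclusionInDoubleDualLi ℝ (E := E)).norm_map y]
  refine norm_le_of_weakStar_tendsto
    (D := fun n => NormedSpace.inclusionInDoubleDual ℝ E (d n))
    (F := NormedSpace.inclusionInDoubleDual ℝ E y) (l := l) hy ?_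
  filter_upwards [hd] with n hn
  exact (NormedSpace.double_dual_bound ℝ E _).trans hn

/-- A form of Goldstine's theorem. -/
theorem exists_ultrafilter_tendsto_bidual (ξ : StrongDual ℝ (StrongDual ℝ E)) :
    ∃ U : Ultrafilter E, (∀ᶠ v in (U : Filter E), ‖v‖ ≤ ‖ξ‖ + 1) ∧
      ∀ φ : StrongDual ℝ E, Tendsto φ U (𝓝 (ξ φ)) := by
  classical
  set r := ‖ξ‖ + 1 with hr
  have hr0 : 0 < r := by positivity
  let J : E → (StrongDual ℝ E → ℝ) := fun v φ => φ v
  have key : (fun φ => ξ φ) ∈ closure (J '' Metric.closedBall 0 r) := by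
    rw [mem_closure_iff]
    intro o ho hξo
    obtain ⟨I, u, hu, huo⟩ := isOpen_pi_iff.1 ho _ hξo
    let T : E →ₗ[ℝ] (I → ℝ) := LinearMap.pi fun i => (i.1 : E →ₗ[ℝ] ℝ)
    have hmem : (fun i : I => ξ i.1) ∈ closure (T '' Metric.closedBall 0 r) := by
      by_contra hnot
      have hconv : Convex ℝ (closure (T '' Metric.closedBall 0 r)) :=
        ((convex_closedBall (0 : E) r).linear_image T).closure
      obtain ⟨f, s, hf, hs⟩ := geometric_hahn_banach_closed_point hconv isClosed_closure hnot
      let φ : StrongDual ℝ E := ∑ i : I, f (Pi.single i 1) • i.1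
      have hfT : ∀ w : I → ℝ, f w = ∑ i : I, w i * f (Pi.single i 1) := by
        intro w
        conv_lhs => rw [pi_eq_sum_univ' w]
        rw [map_sum]
        refine Finset.sum_congr rfl fun i _ => ?_
        rw [map_smul, smul_eq_mul]
      have hφ : ∀ v, φ v = f (T v) := by
        intro v
        rw [hfT]
        simp only [φ, _root_.sum_apply, _root_.smul_apply, smul_eq_mul]
        exact Finset.sum_congr rfl fun i _ => mul_comm _ _
      have hξφ : ξ φ = f (fun i : I => ξ i.1) := by
        rw [hfT]
        simp only [φ, map_sum, map_smul, smul_eq_mul]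
        exact Finset.sum_congr rfl fun i _ => mul_comm _ _
      have hle : ∀ v, ‖v‖ ≤ r → φ v ≤ s := by
        intro v hv
        rw [hφ]
        exact (hf _ (subset_closure ⟨v, by simpa using hv, rfl⟩)).le
      have hs0 : 0 ≤ s := by simpa using hle 0 (by simpa using hr0.le)
      have hφn : ‖φ‖ ≤ s / r := by
        refine φ.opNorm_le_bound (by positivity) fun v => ?_
        refine LinearMap.bound_of_ball_bound' hr0 s (φ : E →ₗ[ℝ] ℝ) (fun z hz => ?_) v
        have hz' : ‖z‖ ≤ r := by simpa using hz
        refine abs_le.2 ⟨?_, hle z hz'⟩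
        have := hle (-z) (by simpa using hz')
        rw [map_neg] at this
        simpa using neg_le.1 this
      have h1 : ξ φ ≤ ‖ξ‖ * ‖φ‖ := (le_abs_self _).trans (ξ.le_opNorm φ)
      have h2 : ‖ξ‖ * ‖φ‖ ≤ r * (s / r) := by
        gcongr
        linarith
      rw [mul_div_cancel₀ _ hr0.ne'] at h2
      rw [hξφ] at h1
      linarith
    obtain ⟨w, hw, v, hv, rfl⟩ := mem_closure_iff.1 hmem {w | ∀ i : I, w i ∈ u i.1} (by
      have : {w : I → ℝ | ∀ i : I, w i ∈ u i.1} = ⋂ i : I, {w | w i ∈ u i.1} := by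
        ext; simp
      rw [this]
      exact isOpen_iInter_of_finite fun i => (hu i.1 i.2).1.preimage (continuous_apply i))
      (fun i => (hu i.1 i.2).2)
    exact ⟨J v, huo fun i hi => hw ⟨i, hi⟩, v, hv, rfl⟩
  rw [mem_closure_iff_ultrafilter] at key
  obtain ⟨W, hW, hWξ⟩ := key
  have hne : (comap J (W : Filter _) ⊓ 𝓟 (Metric.closedBall 0 r)).NeBot := by
    rw [← Filter.map_neBot_iff J, Filter.push_pull', map_principal]
    rw [inf_eq_left.2 (le_principal_iff.2 hW)]
    exact W.neBot
  refine ⟨Ultrafilter.of (comap J (W : Filter _) ⊓ 𝓟 (Metric.closedBall 0 r)), ?_, fun φ => ?_⟩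
  · have := (Ultrafilter.of_le (comap J (W : Filter _) ⊓ 𝓟 (Metric.closedBall 0 r))).trans inf_le_right
    filter_upwards [this (mem_principal_self _)] with v hv
    simpa using hv
  · have h1 : Tendsto J (Ultrafilter.of (comap J (W : Filter _) ⊓ 𝓟 (Metric.closedBall 0 r)))
        (W : Filter _) :=
      tendsto_comap.mono_left ((Ultrafilter.of_le _).trans inf_le_left)
    exact ((continuous_apply φ).tendsto _).comp (h1.mono_right hWξ)

end Preliminaries

section AsymptoticGame

variable {Y : Type*} [NormedAddCommGroup Y] [NormedSpace ℝ Y]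

/-- From position `b`, the subspace player can keep the norm of the sum of `b` and of `m` further
vectors of the unit ball below `B`. -/
def SubspaceGame (B : ℝ) : ℕ → Y → Prop
  | 0, b => ‖b‖ ≤ B
  | m + 1, b => ∃ Z : Submodule ℝ Y, FinCodimClosed Z ∧ ∀ v ∈ Z, ‖v‖ ≤ 1 → SubspaceGame B m (b + v)

/-- The variant of `SubspaceGame` played with weakly null vectors. -/
def WeakGame (B : ℝ) : ℕ → Y → Prop
  | 0, b => ‖b‖ ≤ B
  | m + 1, b => ∀ᶠ v in weakZero Y, ‖v‖ ≤ 1 → WeakGame B m (b + v)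

theorem SubspaceGame.weakGame {B η : ℝ} (hη : 0 < η) : ∀ (m : ℕ) {b b' : Y} {e : ℝ},
    SubspaceGame B m b → ‖b' - b‖ ≤ e → WeakGame (B + e + m * η) m b'
  | 0, b, b', e, h, he => by
    have h : ‖b‖ ≤ B := h
    have : ‖b'‖ ≤ ‖b‖ + ‖b' - b‖ := by simpa using norm_add_le b (b' - b)
    simp only [WeakGame, Nat.cast_zero, zero_mul]
    linarith
  | m + 1, b, b', e, ⟨Z, hZ, h⟩, he => by
    have key := hZ.eventually_exists_near hη
    simp only [WeakGame]
    filter_upwards [key] with v hv hv1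
    obtain ⟨z, hz, hz1, hvz⟩ := hv hv1
    have h2 := (h z hz hz1).weakGame hη m (b' := b' + v) (e := e + η) (by
      have : b' + v - (b + z) = (b' - b) + (v - z) := by abel
      rw [this]
      exact (norm_add_le _ _).trans (add_le_add he hvz))
    convert h2 using 1
    push_cast
    ring

theorem EquivLinftyBasis.norm_sum_le {D : ℝ} {k : ℕ} {x : Fin k → Y} (h : EquivLinftyBasis D x)
    (hD : 0 ≤ D) (hx : ∀ i, ‖x i‖ = 1) {a : Fin k → ℝ} (ha : ∀ i, |a i| ≤ 1) :
    ‖∑ i, a i • x i‖ ≤ D := by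
  obtain ⟨A, B, hA, hB, hAB, h⟩ := h
  rcases Nat.eq_zero_or_pos k with rfl | hk
  · simpa using hD
  have : Nonempty (Fin k) := ⟨⟨0, hk⟩⟩
  have h1 : 1 ≤ A := by
    let i0 : Fin k := ⟨0, hk⟩
    have h2 := (h (Pi.single i0 1)).1
    have h3 : ∑ i, (Pi.single i0 1 : Fin k → ℝ) i • x i = x i0 := by
      rw [Finset.sum_eq_single i0] <;> simp +contextual
    rw [h3, hx] at h2
    have h4 : 1 ≤ ⨆ i, |(Pi.single i0 1 : Fin k → ℝ) i| := by
      have := le_ciSup (f := fun i => |(Pi.single i0 1 : Fin k → ℝ) i|)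
        (Set.finite_range _).bddAbove i0
      simpa using this
    rw [one_div, inv_mul_le_iff₀ hA] at h2
    linarith
  have h5 : (⨆ i, |a i|) ≤ 1 := ciSup_le ha
  calc ‖∑ i, a i • x i‖ ≤ B * ⨆ i, |a i| := (h a).2
    _ ≤ B * 1 := by gcongr
    _ ≤ D := by nlinarith

theorem subspaceGame_of_finiteDimensional [FiniteDimensional ℝ Y] {B : ℝ} :
    ∀ (m : ℕ) {b : Y}, ‖b‖ ≤ B → SubspaceGame B m b
  | 0, _, h => h
  | m + 1, b, h => by
    refine ⟨⊥, ⟨Submodule.closed_of_finiteDimensional _, inferInstance⟩, fun v hv _ => ?_⟩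
    rw [Submodule.mem_bot] at hv
    subst hv
    exact subspaceGame_of_finiteDimensional m (by simpa using h)

theorem FinCodimClosed.exists_norm_eq_one {Z : Submodule ℝ Y} (hZ : FinCodimClosed Z)
    (hY : ¬ FiniteDimensional ℝ Y) : ∃ u ∈ Z, ‖u‖ = 1 := by
  have hne : Z ≠ ⊥ := by
    rintro rfl
    have := hZ.2
    exact hY (Module.Finite.equiv (Submodule.quotEquivOfEqBot (⊥ : Submodule ℝ Y) rfl))
  obtain ⟨z, hz, hz0⟩ := Submodule.exists_mem_ne_zero_of_ne_bot hne
  refine ⟨‖z‖⁻¹ • z, Z.smul_mem _ hz, ?_⟩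
  rw [norm_smul, norm_inv, norm_norm, inv_mul_cancel₀ (norm_ne_zero_iff.2 hz0)]

theorem subspaceGame_of_strategy {D : ℝ} (hD : 0 ≤ D) {k : ℕ}
    (hY : ¬ FiniteDimensional ℝ Y) (σ : (Σ i : Fin k, (Fin i.1 → Y)) → Submodule ℝ Y)
    (hσ : ∀ p, FinCodimClosed (σ p))
    (h : ∀ x : Fin k → Y,
      (∀ i : Fin k, ‖x i‖ = 1 ∧ x i ∈ σ ⟨i, fun j => x ⟨j.1, j.2.trans i.2⟩⟩) →
        EquivLinftyBasis D x) :
    ∀ (m i : ℕ), i + m = k → ∀ (x : ℕ → Y) (a : ℕ → ℝ),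
      (∀ j (hj : j < k), j < i → ‖x j‖ = 1 ∧ x j ∈ σ ⟨⟨j, hj⟩, fun l => x l⟩ ∧ |a j| ≤ 1) →
      SubspaceGame D m (∑ j ∈ range i, a j • x j)
  | 0, i, hi, x, a, hx => by
    obtain rfl : i = k := by simpa using hi
    simp only [SubspaceGame]
    rw [Finset.sum_range]
    exact (h (fun j => x j) fun j => ⟨(hx j j.2 j.2).1, (hx j j.2 j.2).2.1⟩).norm_sum_le hD
      (fun j => (hx j j.2 j.2).1) (a := fun j => a j) fun j => (hx j j.2 j.2).2.2
  | m + 1, i, hi, x, a, hx => by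
    have hik : i < k := by omega
    refine ⟨σ ⟨⟨i, hik⟩, fun l => x l⟩, hσ _, fun v hv hv1 => ?_⟩
    obtain ⟨u, c, hu, hu1, hc, rfl⟩ : ∃ (u : Y) (c : ℝ), u ∈ σ ⟨⟨i, hik⟩, fun l => x l⟩ ∧
        ‖u‖ = 1 ∧ |c| ≤ 1 ∧ v = c • u := by
      by_cases hv0 : v = 0
      · obtain ⟨u, hu, hu1⟩ := (hσ ⟨⟨i, hik⟩, fun l => x l⟩).exists_norm_eq_one hY
        exact ⟨u, 0, hu, hu1, by simp, by simp [hv0]⟩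
      · refine ⟨‖v‖⁻¹ • v, ‖v‖, Submodule.smul_mem _ _ hv, ?_, by simpa using hv1, ?_⟩
        · rw [norm_smul, norm_inv, norm_norm, inv_mul_cancel₀ (norm_ne_zero_iff.2 hv0)]
        · rw [smul_smul, mul_inv_cancel₀ (norm_ne_zero_iff.2 hv0), one_smul]
    have h1 := subspaceGame_of_strategy hD hY σ hσ h m (i + 1) (by omega)
      (Function.update x i u) (Function.update a i c) (by
        intro j hj hji
        have hpre : (fun l : Fin j => Function.update x i u l) = fun l : Fin j => x l := by
          funext l
          exact Function.update_of_ne (by have := l.2; omega) _ _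
        rw [hpre]
        rcases (Nat.lt_succ_iff_lt_or_eq.1 hji) with hlt | rfl
        · rw [Function.update_of_ne hlt.ne, Function.update_of_ne hlt.ne]
          exact hx j hj hlt
        · simp only [Function.update_self]
          exact ⟨hu1, hu, hc⟩)
    rw [Finset.sum_range_succ, Function.update_self, Function.update_self] at h1
    convert h1 using 2
    refine Finset.sum_congr rfl fun j hj => ?_
    have := Finset.mem_range.1 hj
    rw [Function.update_of_ne this.ne, Function.update_of_ne this.ne]

theorem AsymptoticC0.exists_weakGame (h : AsymptoticC0 Y) :
    ∃ B : ℝ, 0 < B ∧ ∀ k, WeakGame B k (0 : Y) := by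
  obtain ⟨C, hC, h⟩ := h
  refine ⟨C + 2, by linarith, fun k => ?_⟩
  have h1 : SubspaceGame (C + 1) k (0 : Y) := by
    by_cases hY : FiniteDimensional ℝ Y
    · exact subspaceGame_of_finiteDimensional k (by simp; linarith)
    · obtain ⟨σ, hσ, hx⟩ := h k 1 one_pos
      simpa using subspaceGame_of_strategy (by linarith) hY σ hσ hx k 0 (by simp)
        (fun _ => 0) (fun _ => 0) (by simp)
  have hk : (0 : ℝ) < k + 1 := by positivity
  have h2 := h1.weakGame (η := 1 / (k + 1)) (by positivity) k (b' := 0) (e := 1 / (k + 1))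
    (by simp; positivity)
  convert h2 using 1
  field_simp
  ring

end AsymptoticGame

section IteratedEventually

variable {α : Type*}

/-- The predicate `p` holds for iterated almost every choice along a list of ultrafilters. -/
def IteratedEventually : List (Ultrafilter α) → (List α → Prop) → Prop
  | [], p => p []
  | U :: Us, p => ∀ᶠ v in U, IteratedEventually Us fun l => p (v :: l)

theorem IteratedEventually.mono : ∀ (Us : List (Ultrafilter α)) {p q : List α → Prop},
    IteratedEventually Us p → (∀ l, p l → q l) → IteratedEventually Us q
  | [], _, _, h, hpq => hpq _ h
  | U :: Us, _, _, h, hpq => by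
    have h : ∀ᶠ v in (U : Filter α), _ := h
    exact h.mono fun v hv => IteratedEventually.mono Us hv fun l hl => hpq _ hl

theorem IteratedEventually.exists : ∀ (Us : List (Ultrafilter α)) {p : List α → Prop},
    IteratedEventually Us p → ∃ l, p l
  | [], _, h => ⟨_, h⟩
  | U :: Us, _, h => by
    have h : ∀ᶠ v in (U : Filter α), _ := h
    obtain ⟨v, hv⟩ := Filter.Eventually.exists h
    obtain ⟨l, hl⟩ := IteratedEventually.exists Us hv
    exact ⟨_, hl⟩

end IteratedEventually

theorem eventually_norm_le_of_lipschitz_at_scale {X Y : Type*} [NormedAddCommGroup X]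
    [NormedAddCommGroup Y] {h : X → Y} {r L : ℝ}
    (hg : ∀ x y, ‖x - y‖ ≤ 2 * r → ‖h x - h y‖ ≤ L) (U : Ultrafilter X)
    (hU : ∀ᶠ v in (U : Filter X), ‖v‖ ≤ r) (b : X) :
    ∃ c, ∀ᶠ v in (U : Filter X), ‖h (b + v)‖ ≤ c := by
  obtain ⟨v0, hv0⟩ := hU.exists
  refine ⟨‖h (b + v0)‖ + L, ?_⟩
  filter_upwards [hU] with v hv
  have h1 := hg (b + v) (b + v0) (by
    rw [add_sub_add_left_eq_sub]
    exact (norm_sub_le _ _).trans (by linarith))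
  have h2 := norm_add_le (h (b + v0)) (h (b + v) - h (b + v0))
  rw [add_sub_cancel] at h2
  linarith

section Concentration

variable {X Y : Type*} [NormedAddCommGroup X] [NormedAddCommGroup Y] [NormedSpace ℝ Y]

open Classical in
/-- The weak limit of `d` along `U`, with junk value `0`. -/
noncomputable def weakLimit {I : Type*} (U : Ultrafilter I) (d : I → Y) : Y :=
  if h : ∃ y : Y, ∀ φ : StrongDual ℝ Y, Tendsto (fun n => φ (d n)) U (𝓝 (φ y)) then h.choose else 0

theorem tendsto_weakLimit (hY : IsReflexiveSpace Y) {I : Type*} (U : Ultrafilter I) (d : I → Y)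
    {c : ℝ} (hd : ∀ᶠ n in U, ‖d n‖ ≤ c) (φ : StrongDual ℝ Y) :
    Tendsto (fun n => φ (d n)) U (𝓝 (φ (weakLimit U d))) := by
  have h := hY.exists_weak_limit U d hd
  rw [weakLimit, dif_pos h]
  exact h.choose_spec φ

/-- The iterated weak limit of `g (b + v₁ + ⋯ + vₙ)` along a list of ultrafilters. -/
noncomputable def iteratedWeakLimit (g : X → Y) : List (Ultrafilter X) → X → Y
  | [], b => g b
  | U :: Us, b => weakLimit U fun v => iteratedWeakLimit g Us (b + v)

variable {g : X → Y} {r L : ℝ}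

theorem norm_iteratedWeakLimit_sub_le (hY : IsReflexiveSpace Y)
    (hg : ∀ x y, ‖x - y‖ ≤ 2 * r → ‖g x - g y‖ ≤ L) :
    ∀ (Us : List (Ultrafilter X)), (∀ U ∈ Us, ∀ᶠ v in (U : Filter X), ‖v‖ ≤ r) → ∀ x y : X,
      ‖x - y‖ ≤ 2 * r → ‖iteratedWeakLimit g Us x - iteratedWeakLimit g Us y‖ ≤ L
  | [], _, x, y, hxy => hg x y hxy
  | U :: Us, hUs, x, y, hxy => by
    have ih := norm_iteratedWeakLimit_sub_le hY hg Us fun U hU => hUs U (List.mem_cons_of_mem _ hU)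
    have hU := hUs U List.mem_cons_self
    have hlim : ∀ (b : X) (φ : StrongDual ℝ Y), Tendsto
        (fun v => φ (iteratedWeakLimit g Us (b + v))) U (𝓝 (φ (iteratedWeakLimit g (U :: Us) b))) := by
      intro b φ
      obtain ⟨c, hc⟩ := eventually_norm_le_of_lipschitz_at_scale ih U hU b
      exact tendsto_weakLimit hY U _ hc φ
    refine norm_le_of_weak_tendsto (l := (U : Filter X))
      (d := fun v => iteratedWeakLimit g Us (x + v) - iteratedWeakLimit g Us (y + v)) ?_ ?_
    · intro φ
      simp only [map_sub]
      exact (hlim x φ).sub (hlim y φ)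
    · exact Eventually.of_forall fun v => ih _ _ (by simpa using hxy)

theorem WeakGame.iteratedEventually (hY : IsReflexiveSpace Y) {B : ℝ} (hL : 0 < L)
    (hg : ∀ x y, ‖x - y‖ ≤ 2 * r → ‖g x - g y‖ ≤ L) :
    ∀ (Us : List (Ultrafilter X)), (∀ U ∈ Us, ∀ᶠ v in (U : Filter X), ‖v‖ ≤ r) → ∀ (b : X) (c : Y),
      WeakGame B Us.length c → IteratedEventually Us fun l =>
        ‖c + L⁻¹ • (g (b + l.sum) - iteratedWeakLimit g Us b)‖ ≤ B
  | [], _, b, c, h => by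
    simpa [IteratedEventually, iteratedWeakLimit, WeakGame] using h
  | U :: Us, hUs, b, c, h => by
    have hUs' : ∀ U ∈ Us, ∀ᶠ v in (U : Filter X), ‖v‖ ≤ r :=
      fun U hU => hUs U (List.mem_cons_of_mem _ hU)
    have hlip := norm_iteratedWeakLimit_sub_le hY hg Us hUs'
    have hU := hUs U List.mem_cons_self
    obtain ⟨K, hK⟩ := eventually_norm_le_of_lipschitz_at_scale hlip U hU b
    have hlim := tendsto_weakLimit hY U (fun v => iteratedWeakLimit g Us (b + v)) hK
    set d : X → Y := fun v =>
      L⁻¹ • (iteratedWeakLimit g Us (b + v) - iteratedWeakLimit g (U :: Us) b) with hd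
    have hd1 : ∀ᶠ v in (U : Filter X), ‖d v‖ ≤ 1 := by
      filter_upwards [hU] with v hv
      have : ‖iteratedWeakLimit g Us (b + v) - iteratedWeakLimit g (U :: Us) b‖ ≤ L := by
        refine norm_le_of_weak_tendsto (l := (U : Filter X))
          (d := fun w => iteratedWeakLimit g Us (b + v) - iteratedWeakLimit g Us (b + w)) ?_ ?_
        · intro φ
          simp only [map_sub]
          exact tendsto_const_nhds.sub (hlim φ)
        · filter_upwards [hU] with w hw
          refine hlip _ _ ?_
          rw [add_sub_add_left_eq_sub]
          exact (norm_sub_le _ _).trans (by linarith)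
      rw [hd, norm_smul, norm_inv, Real.norm_of_nonneg hL.le, inv_mul_le_iff₀ hL]
      linarith
    have hd0 : Tendsto d U (weakZero Y) := by
      rw [tendsto_weakZero_iff]
      intro φ
      have := ((hlim φ).sub_const (φ (iteratedWeakLimit g (U :: Us) b))).const_mul L⁻¹
      simpa [hd, iteratedWeakLimit] using this
    change ∀ᶠ v in (U : Filter X), _
    have h : ∀ᶠ v in weakZero Y, ‖v‖ ≤ 1 → WeakGame B Us.length (c + v) := h
    filter_upwards [hd0.eventually h, hd1] with v hv hv1
    refine IteratedEventually.mono Us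
      (WeakGame.iteratedEventually hY hL hg Us hUs' (b + v) _ (hv hv1)) fun l hl => ?_
    convert hl using 2
    rw [List.sum_cons, hd, add_assoc c, ← smul_add, add_assoc b]
    congr 2
    abel

variable [NormedSpace ℝ X]

theorem norm_sub_le_of_iteratedEventually {R : ℝ} :
    ∀ (Us : List (Ultrafilter X × StrongDual ℝ (StrongDual ℝ X))),
      (∀ p ∈ Us, ∀ φ : StrongDual ℝ X, Tendsto φ p.1 (𝓝 (p.2 φ))) →
      ∀ ζ : StrongDual ℝ (StrongDual ℝ X), IteratedEventually (Us.map Prod.fst)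
        (fun l => ‖ζ - NormedSpace.inclusionInDoubleDual ℝ X l.sum‖ ≤ R) →
      ‖ζ - (Us.map Prod.snd).sum‖ ≤ R
  | [], _, ζ, h => by
    simpa [IteratedEventually] using h
  | (U, ξ) :: Us, hUs, ζ, h => by
    have hξ := hUs (U, ξ) List.mem_cons_self
    have h : ∀ᶠ v in (U : Filter X), IteratedEventually (Us.map Prod.fst) fun l =>
      ‖ζ - NormedSpace.inclusionInDoubleDual ℝ X (v :: l).sum‖ ≤ R := h
    refine norm_le_of_weakStar_tendsto (l := (U : Filter X)) (D := fun v =>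
      (ζ - NormedSpace.inclusionInDoubleDual ℝ X v) - (Us.map Prod.snd).sum) ?_ ?_
    · intro φ
      have := ((hξ φ).const_sub (ζ φ)).sub_const ((Us.map Prod.snd).sum φ)
      simpa [sub_sub] using this
    · filter_upwards [h] with v hv
      refine norm_sub_le_of_iteratedEventually Us
        (fun p hp => hUs p (List.mem_cons_of_mem _ hp)) _ ?_
      refine IteratedEventually.mono _ hv fun l hl => ?_
      have e : ζ - NormedSpace.inclusionInDoubleDual ℝ X v -
          NormedSpace.inclusionInDoubleDual ℝ X l.sum =
          ζ - NormedSpace.inclusionInDoubleDual ℝ X (v :: l).sum := by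
        rw [List.sum_cons, map_add]
        exact sub_sub (α := StrongDual ℝ (StrongDual ℝ X)) _ _ _
      exact e ▸ hl

/-- Concentration: sums of vectors picked along ultrafilters in the ball of radius `r` stay within a
distance of the sum of the weak-* limits that does not depend on the number of summands. -/
theorem CoarseEmbedding.exists_concentration (hY : IsReflexiveSpace Y) (hYc : AsymptoticC0 Y)
    (hg : CoarseEmbedding g) (r : ℝ) :
    ∃ R : ℝ, ∀ Us : List (Ultrafilter X × StrongDual ℝ (StrongDual ℝ X)),
      (∀ p ∈ Us, (∀ᶠ v in (p.1 : Filter X), ‖v‖ ≤ r) ∧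
        ∀ φ : StrongDual ℝ X, Tendsto φ p.1 (𝓝 (p.2 φ))) →
      IteratedEventually (Us.map Prod.fst) fun l =>
        ‖NormedSpace.inclusionInDoubleDual ℝ X l.sum - (Us.map Prod.snd).sum‖ ≤ R := by
  obtain ⟨B, hB, hgame⟩ := hYc.exists_weakGame
  obtain ⟨L', hL'⟩ := hg.1 (2 * r)
  set L := max L' 1 with hLdef
  have hL : 0 < L := lt_max_of_lt_right one_pos
  have hlip : ∀ x y, ‖x - y‖ ≤ 2 * r → ‖g x - g y‖ ≤ L := by
    intro x y hxy
    rw [← dist_eq_norm] at hxy ⊢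
    exact (hL' x y hxy).trans (le_max_left _ _)
  obtain ⟨R, hR⟩ := hg.2 (2 * (L * B) + 1)
  refine ⟨R, fun Us hUs => ?_⟩
  have h1 := WeakGame.iteratedEventually hY hL hlip (Us.map Prod.fst) (by
    intro U hU
    obtain ⟨p, hp, rfl⟩ := List.mem_map.1 hU
    exact (hUs p hp).1) (0 : X) 0 (hgame _)
  have h2 : IteratedEventually (Us.map Prod.fst) fun l =>
      ‖g l.sum - iteratedWeakLimit g (Us.map Prod.fst) 0‖ ≤ L * B := by
    refine IteratedEventually.mono _ h1 fun l hl => ?_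
    rwa [zero_add, zero_add, norm_smul, norm_inv, Real.norm_of_nonneg hL.le,
      inv_mul_le_iff₀ hL] at hl
  refine IteratedEventually.mono _ h2 fun l hl => ?_
  refine norm_sub_le_of_iteratedEventually Us (fun p hp => (hUs p hp).2) _ ?_
  refine IteratedEventually.mono _ h2 fun l' hl' => ?_
  have e : NormedSpace.inclusionInDoubleDual ℝ X l.sum -
      NormedSpace.inclusionInDoubleDual ℝ X l'.sum =
      NormedSpace.inclusionInDoubleDual ℝ X (l.sum - l'.sum) := (map_sub _ _ _).symm
  rw [e]
  refine (NormedSpace.double_dual_bound ℝ X _).trans ?_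
  by_contra! hlt
  have h3 := hR l.sum l'.sum (by rw [dist_eq_norm]; exact hlt.le)
  have h4 := dist_triangle_right (g l.sum) (g l'.sum) (iteratedWeakLimit g (Us.map Prod.fst) 0)
  rw [dist_eq_norm (g l.sum) (iteratedWeakLimit g _ _),
    dist_eq_norm (g l'.sum) (iteratedWeakLimit g _ _)] at h4
  linarith

theorem dist_inv_smul_lt {E : Type*} [NormedAddCommGroup E] [NormedSpace ℝ E] {x y : E} {k : ℕ}
    {R ε : ℝ} (hε : 0 < ε) (hk : R / ε < k) (h : ‖y - (k + 1) • x‖ ≤ R) :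
    dist x (((k : ℝ) + 1)⁻¹ • y) < ε := by
  have hk0 : (0 : ℝ) < k + 1 := by positivity
  have h2 : ((k : ℝ) + 1)⁻¹ • y - x = ((k : ℝ) + 1)⁻¹ • (y - (k + 1) • x) := by
    rw [← Nat.cast_smul_eq_nsmul ℝ, smul_sub, smul_smul]
    push_cast
    rw [inv_mul_cancel₀ hk0.ne', one_smul]
  rw [dist_comm, dist_eq_norm, h2, norm_smul, norm_inv, Real.norm_of_nonneg hk0.le,
    inv_mul_lt_iff₀ hk0]
  rw [div_lt_iff₀ hε] at hk
  nlinarith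

theorem CoarseEmbedding.isReflexiveSpace [CompleteSpace X] (hY : IsReflexiveSpace Y)
    (hYc : AsymptoticC0 Y) (hg : CoarseEmbedding g) : IsReflexiveSpace X := by
  intro ξ
  obtain ⟨U, hU, hUξ⟩ := exists_ultrafilter_tendsto_bidual ξ
  obtain ⟨R, hR⟩ := hg.exists_concentration hY hYc (‖ξ‖ + 1)
  have hclosed : IsClosed (Set.range (NormedSpace.inclusionInDoubleDual ℝ X)) :=
    (NormedSpace.inclusionInDoubleDualLi ℝ (E := X)).isometry.isUniformInducing.isComplete_range.isClosed
  suffices h : ξ ∈ closure (Set.range (NormedSpace.inclusionInDoubleDual ℝ X)) by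
    rwa [hclosed.closure_eq] at h
  refine (Metric.mem_closure_iff (α := StrongDual ℝ (StrongDual ℝ X))).2 fun ε hε => ?_
  obtain ⟨k, hk⟩ := exists_nat_gt (R / ε)
  have h1 := hR (List.replicate (k + 1) (U, ξ)) (by
    intro p hp
    obtain rfl := List.eq_of_mem_replicate hp
    exact ⟨hU, hUξ⟩)
  obtain ⟨l, hl⟩ := h1.exists
  refine ⟨_, ⟨((k : ℝ) + 1)⁻¹ • l.sum, rfl⟩, ?_⟩
  rw [map_smul]
  refine dist_inv_smul_lt (E := StrongDual ℝ (StrongDual ℝ X)) hε hk ?_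
  rwa [List.map_replicate, List.sum_replicate] at hl

end Concentration

section BoundedSums

/-- In `X`, sums of vectors picked along weakly null ultrafilters in a ball stay bounded, uniformly
in the number of summands. -/
def BoundedWeaklyNullSums (X : Type*) [NormedAddCommGroup X] [NormedSpace ℝ X] : Prop :=
  ∀ r : ℝ, ∃ R : ℝ, ∀ Us : List (Ultrafilter X),
    (∀ U ∈ Us, (∀ᶠ v in (U : Filter X), ‖v‖ ≤ r) ∧ (U : Filter X) ≤ weakZero X) →
    IteratedEventually Us fun l => ‖l.sum‖ ≤ R

theorem CoarseEmbedding.boundedWeaklyNullSums {X Y : Type*} [NormedAddCommGroup X]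
    [NormedSpace ℝ X] [NormedAddCommGroup Y] [NormedSpace ℝ Y] {g : X → Y} (hY : IsReflexiveSpace Y) (hYc : AsymptoticC0 Y) (hg : CoarseEmbedding g) :
    BoundedWeaklyNullSums X := by
  intro r
  obtain ⟨R, hR⟩ := hg.exists_concentration hY hYc r
  refine ⟨R, fun Us hUs => ?_⟩
  have h := hR (Us.map fun U => (U, 0)) (by
    intro p hp
    obtain ⟨U, hU, rfl⟩ := List.mem_map.1 hp
    exact ⟨(hUs U hU).1, fun φ => tendsto_of_le_weakZero (hUs U hU).2 φ⟩)
  have e1 : (Us.map fun U => (U, (0 : StrongDual ℝ (StrongDual ℝ X)))).map Prod.fst = Us := by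
    simp [Function.comp_def]
  have e2 : ((Us.map fun U => (U, (0 : StrongDual ℝ (StrongDual ℝ X)))).map Prod.snd).sum = 0 := by
    rw [List.map_map]
    exact List.sum_map_zero
  rw [e1] at h
  refine IteratedEventually.mono _ h fun l hl => ?_
  rw [e2] at hl
  have e3 := (NormedSpace.inclusionInDoubleDualLi ℝ (E := X)).norm_map l.sum
  rw [← e3]
  refine le_trans (le_of_eq ?_) hl
  exact congrArg norm (sub_zero (NormedSpace.inclusionInDoubleDual ℝ X l.sum)).symm

end BoundedSums

section Array

variable {X T : Type*} [AddCommMonoid X] [DecidableEq T] {U : T → Ultrafilter X}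

/-- The iterated product of the ultrafilters `U s`, for `s` in a list, on the functions `T → X`. -/
def arrayFilter (U : T → Ultrafilter X) : List T → Filter (T → X)
  | [] => pure 0
  | s :: ss => (U s : Filter X).bind fun v => (arrayFilter U ss).map fun α => Function.update α s v

theorem eventually_arrayFilter_cons {s : T} {ss : List T} {p : (T → X) → Prop} :
    (∀ᶠ α in arrayFilter U (s :: ss), p α) ↔
      ∀ᶠ v in (U s : Filter X), ∀ᶠ α in arrayFilter U ss, p (Function.update α s v) := by
  simp only [arrayFilter, eventually_bind, eventually_map]

theorem arrayFilter_neBot : ∀ ss : List T, (arrayFilter U ss).NeBot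
  | [] => by
    rw [arrayFilter]
    infer_instance
  | s :: ss => by
    have := arrayFilter_neBot ss
    rw [← frequently_true_iff_neBot]
    intro h
    obtain ⟨v, hv⟩ := (eventually_arrayFilter_cons.1 h).exists
    obtain ⟨α, hα⟩ := hv.exists
    exact hα trivial

theorem eventually_arrayFilter_of_mem {t : T} {p : X → Prop} (hp : ∀ᶠ v in (U t : Filter X), p v) :
    ∀ {ss : List T}, ss.Nodup → t ∈ ss → ∀ᶠ α in arrayFilter U ss, p (α t)
  | s :: ss, hss, ht => by
    rw [eventually_arrayFilter_cons]
    rcases List.mem_cons.1 ht with rfl | ht'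
    · simp only [Function.update_self]
      exact hp.mono fun v hv => Eventually.of_forall fun _ => hv
    · have hne : t ≠ s := by
        rintro rfl
        exact (List.nodup_cons.1 hss).1 ht'
      simp only [Function.update_of_ne hne]
      exact Eventually.of_forall fun v =>
        eventually_arrayFilter_of_mem hp (List.nodup_cons.1 hss).2 ht'

theorem eventually_arrayFilter_of_iteratedEventually {x : T → X → X} :
    ∀ {ss : List T} {q : X → Prop}, ss.Nodup →
      IteratedEventually (ss.map fun s => (U s).map (x s)) (fun l => q l.sum) →
      ∀ᶠ α in arrayFilter U ss, q (ss.map fun s => x s (α s)).sum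
  | [], q, _, h => by
    have h : q ([] : List X).sum := h
    exact Eventually.of_forall fun _ => h
  | s :: ss, q, hss, h => by
    have h : ∀ᶠ v in (U s : Filter X), IteratedEventually (ss.map fun s => (U s).map (x s))
      (fun l => q (x s v :: l).sum) := h
    rw [eventually_arrayFilter_cons]
    filter_upwards [h] with v hv
    simp only [List.sum_cons] at hv
    filter_upwards [eventually_arrayFilter_of_iteratedEventually (q := fun z => q (x s v + z))
      (List.nodup_cons.1 hss).2 hv] with α hα
    rw [List.map_cons, List.sum_cons, Function.update_self]
    convert hα using 3
    refine List.map_congr_left fun t ht => ?_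
    rw [Function.update_of_ne]
    rintro rfl
    exact (List.nodup_cons.1 hss).1 ht

end Array

section ArrayLimits

variable {X T : Type*} [NormedAddCommGroup X] [NormedSpace ℝ X] [DecidableEq T]
  {U : T → Ultrafilter X}

theorem tendsto_arrayFilter_cross {x : T → X → X} (hx : ∀ s, Tendsto (x s) (U s) (weakZero X))
    {f : T → StrongDual ℝ X} {fc : T → X → StrongDual ℝ X}
    (hf : ∀ s z, Tendsto (fun v => fc s v z) (U s) (𝓝 (f s z))) {s t : T} (hst : s ≠ t)
    {N : Set ℝ} (hN : N ∈ 𝓝 0) : ∀ {ss : List T}, ss.Nodup → s ∈ ss → t ∈ ss →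
      ∀ᶠ α in arrayFilter U ss, fc s (α s) (x t (α t)) ∈ N
  | u :: ss, hss, hs, ht => by
    obtain ⟨hu, hss'⟩ := List.nodup_cons.1 hss
    rw [eventually_arrayFilter_cons]
    have hφ : ∀ φ : StrongDual ℝ X, Tendsto (fun v => φ (x t v)) (U t) (𝓝 0) :=
      fun φ => tendsto_weakZero_iff.1 (hx t) φ
    rcases List.mem_cons.1 hs with rfl | hs'
    · have ht : t ∈ ss := (List.mem_cons.1 ht).resolve_left hst.symm
      simp only [Function.update_self, Function.update_of_ne hst.symm]
      exact Eventually.of_forall fun v =>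
        eventually_arrayFilter_of_mem (p := fun w => fc s v (x t w) ∈ N) (hφ _ hN) hss' ht
    rcases List.mem_cons.1 ht with rfl | ht'
    · simp only [Function.update_self, Function.update_of_ne hst]
      filter_upwards [(hφ (f s)).eventually (eventually_mem_nhds_iff.2 hN)] with v hv
      exact eventually_arrayFilter_of_mem (p := fun w => fc s w (x t v) ∈ N) (hf s _ hv) hss' hs'
    · have h1 : s ≠ u := fun h => hu (h ▸ hs')
      have h2 : t ≠ u := fun h => hu (h ▸ ht')
      simp only [Function.update_of_ne h1, Function.update_of_ne h2]
      exact Eventually.of_forall fun v => tendsto_arrayFilter_cross hx hf hst hN hss' hs' ht'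

theorem exists_array (x : T → X → X) (hx : ∀ s, Tendsto (x s) (U s) (weakZero X))
    (hx1 : ∀ s, ∀ᶠ v in (U s : Filter X), ‖x s v‖ ≤ 1)
    (f : T → StrongDual ℝ X) (fc : T → X → StrongDual ℝ X)
    (hf : ∀ s z, Tendsto (fun v => fc s v z) (U s) (𝓝 (f s z))) {R : ℝ}
    (hR : ∀ Us : List (Ultrafilter X),
      (∀ U ∈ Us, (∀ᶠ v in (U : Filter X), ‖v‖ ≤ 1) ∧ (U : Filter X) ≤ weakZero X) →
      IteratedEventually Us fun l => ‖l.sum‖ ≤ R) :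
    ∃ V : Ultrafilter (X × (T → X)), (∀ᶠ n in (V : Filter (X × (T → X))), ‖n.1‖ ≤ R) ∧
      Tendsto Prod.fst (V : Filter (X × (T → X))) (weakZero X) ∧
      (∀ s, Tendsto (fun n : X × (T → X) => n.2 s) V (U s)) ∧
      ∀ s, Tendsto (fun n : X × (T → X) => fc s (n.2 s) (n.1 - x s (n.2 s))) V (𝓝 0) := by
  set F : Filter (X × (T → X)) := (atTop : Filter (Finset T)).bind fun S =>
    (arrayFilter U S.toList).map fun α => (∑ s ∈ S, x s (α s), α) with hF
  have hev : ∀ {p : X × (T → X) → Prop}, (∀ᶠ n in F, p n) ↔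
      ∀ᶠ S in (atTop : Filter (Finset T)), ∀ᶠ α in arrayFilter U S.toList,
        p (∑ s ∈ S, x s (α s), α) := by
    intro p
    rw [hF, eventually_bind]
    rfl
  have : F.NeBot := by
    rw [← frequently_true_iff_neBot]
    intro h
    obtain ⟨S, hS⟩ := (hev.1 h).exists
    have := arrayFilter_neBot (U := U) S.toList
    obtain ⟨α, hα⟩ := hS.exists
    exact hα trivial
  refine ⟨Ultrafilter.of F, ?_, ?_, ?_, ?_⟩
  · refine Ultrafilter.of_le F (hev.2 (Eventually.of_forall fun S => ?_))
    have := eventually_arrayFilter_of_iteratedEventually (U := U) (x := x)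
      (q := fun z => ‖z‖ ≤ R) S.nodup_toList (hR _ (by
        intro W hW
        obtain ⟨s, -, rfl⟩ := List.mem_map.1 hW
        exact ⟨hx1 s, hx s⟩))
    simpa only [Finset.sum_map_toList] using this
  · refine Tendsto.mono_left ?_ (Ultrafilter.of_le F)
    rw [tendsto_weakZero_iff]
    intro φ N hN
    refine hev.2 (Eventually.of_forall fun S => ?_)
    simp only [map_sum]
    have : Tendsto (fun α : T → X => ∑ s ∈ S, φ (x s (α s))) (arrayFilter U S.toList)
        (𝓝 (∑ s ∈ S, 0)) := by
      refine tendsto_finsetSum _ fun s hs M hM => ?_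
      exact eventually_arrayFilter_of_mem (p := fun v => φ (x s v) ∈ M)
        (tendsto_weakZero_iff.1 (hx s) φ hM) S.nodup_toList (Finset.mem_toList.2 hs)
    rw [Finset.sum_const_zero] at this
    exact this hN
  · refine fun s => Tendsto.mono_left (fun N hN => ?_) (Ultrafilter.of_le F)
    refine hev.2 ((eventually_ge_atTop {s}).mono fun S hS => ?_)
    exact eventually_arrayFilter_of_mem (p := fun v => v ∈ N) hN S.nodup_toList
      (Finset.mem_toList.2 (hS (Finset.mem_singleton_self s)))
  · refine fun s => Tendsto.mono_left (fun N hN => ?_) (Ultrafilter.of_le F)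
    refine hev.2 ((eventually_ge_atTop {s}).mono fun S hS => ?_)
    have hs : s ∈ S := hS (Finset.mem_singleton_self s)
    have : Tendsto (fun α : T → X => ∑ t ∈ S.erase s, fc s (α s) (x t (α t)))
        (arrayFilter U S.toList) (𝓝 (∑ t ∈ S.erase s, 0)) := by
      refine tendsto_finsetSum _ fun t ht M hM => ?_
      obtain ⟨hts, ht⟩ := Finset.mem_erase.1 ht
      exact tendsto_arrayFilter_cross hx hf hts.symm hM S.nodup_toList (Finset.mem_toList.2 hs)
        (Finset.mem_toList.2 ht)
    rw [Finset.sum_const_zero] at this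
    filter_upwards [this hN] with α hα
    have e : ∑ t ∈ S, x t (α t) - x s (α s) = ∑ t ∈ S.erase s, x t (α t) := by
      rw [← Finset.add_sum_erase S _ hs, add_sub_cancel_left]
    change fc s (α s) (∑ t ∈ S, x t (α t) - x s (α s)) ∈ N
    rw [e, map_sum]
    exact hα

end ArrayLimits

section Tree

variable {X : Type*} [NormedAddCommGroup X] [NormedSpace ℝ X]

/-- The filter of weakly null unit vectors. -/
def sphereFilter (X : Type*) [NormedAddCommGroup X] [NormedSpace ℝ X] : Filter X :=
  weakZero X ⊓ 𝓟 {v | ‖v‖ = 1}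

/-- `p` holds for all extensions of a list by `m` generic weakly null unit vectors. The most recent
vector comes first. -/
def SphereEventually (p : List X → Prop) : ℕ → List X → Prop
  | 0, s => p s
  | m + 1, s => ∀ᶠ v in sphereFilter X, SphereEventually p m (v :: s)

theorem SphereEventually.and {p q : List X → Prop} : ∀ {m : ℕ} {s : List X},
    SphereEventually p m s → SphereEventually q m s →
      SphereEventually (fun t => p t ∧ q t) m s
  | 0, _, hp, hq => ⟨hp, hq⟩
  | m + 1, s, hp, hq => by
    have hp : ∀ᶠ v in sphereFilter X, SphereEventually p m (v :: s) := hp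
    have hq : ∀ᶠ v in sphereFilter X, SphereEventually q m (v :: s) := hq
    exact (Filter.Eventually.and hp hq).mono fun v hv => SphereEventually.and hv.1 hv.2

theorem SphereEventually.of_forall_cons {p : List X → Prop}
    (hp : ∀ s, p s → ∀ᶠ v in sphereFilter X, p (v :: s)) : ∀ {m : ℕ} {s : List X},
    p s → SphereEventually p m s
  | 0, _, h => h
  | _ + 1, s, h => (hp s h).mono fun _ hv => SphereEventually.of_forall_cons hp hv

theorem exists_tree_ultrafilter {p : List X → Prop} {k : ℕ} (hp : p [])
    (h : ¬ SphereEventually p k []) :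
    ∃ U : List X → Ultrafilter X, ∀ s, (U s : Filter X) ≤ sphereFilter X ∧
      ∀ m, s.length + (m + 1) = k → ¬ SphereEventually p (m + 1) s →
        ∀ᶠ v in (U s : Filter X), ¬ SphereEventually p m (v :: s) := by
  have hne : (sphereFilter X).NeBot := by
    cases k with
    | zero => exact absurd hp h
    | succ k =>
      refine ⟨fun hbot => h ?_⟩
      change ∀ᶠ v in sphereFilter X, SphereEventually p k [v]
      rw [hbot]
      exact eventually_bot
  have key : ∀ s : List X, ∃ U : Ultrafilter X, (U : Filter X) ≤ sphereFilter X ∧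
      ∀ m, s.length + (m + 1) = k → ¬ SphereEventually p (m + 1) s →
        ∀ᶠ v in (U : Filter X), ¬ SphereEventually p m (v :: s) := by
    intro s
    by_cases hs : ∃ m, s.length + (m + 1) = k ∧ ¬ SphereEventually p (m + 1) s
    · obtain ⟨m, hm, hB⟩ := hs
      have hfreq : ∃ᶠ v in sphereFilter X, ¬ SphereEventually p m (v :: s) :=
        not_eventually.1 hB
      have : (sphereFilter X ⊓ 𝓟 {v | ¬ SphereEventually p m (v :: s)}).NeBot :=
        frequently_mem_iff_neBot.1 hfreq
      refine ⟨Ultrafilter.of (sphereFilter X ⊓ 𝓟 {v | ¬ SphereEventually p m (v :: s)}), (Ultrafilter.of_le _).trans inf_le_left, fun m' hm' _ => ?_⟩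
      obtain rfl : m = m' := by omega
      exact (Ultrafilter.of_le _).trans inf_le_right (mem_principal_self _)
    · exact ⟨Ultrafilter.of _, Ultrafilter.of_le _, fun m hm hB => absurd ⟨m, hm, hB⟩ hs⟩
  choose U hU using key
  exact ⟨U, hU⟩

theorem exists_tree_functionals (U : List X → Ultrafilter X) (k : ℕ)
    (leaf : List X → StrongDual ℝ X) (hleaf : ∀ s, ‖leaf s‖ ≤ 1) :
    ∃ f : List X → StrongDual ℝ X, (∀ s, ‖f s‖ ≤ 1) ∧ (∀ s, s.length = k → f s = leaf s) ∧
      ∀ s, s.length < k → ∀ z, Tendsto (fun v => f (v :: s) z) (U s) (𝓝 (f s z)) := by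
  have step : ∀ G : {G : List X → StrongDual ℝ X // ∀ s, ‖G s‖ ≤ 1},
      ∃ G' : {G : List X → StrongDual ℝ X // ∀ s, ‖G s‖ ≤ 1},
        ∀ s z, Tendsto (fun v => G.1 (v :: s) z) (U s) (𝓝 (G'.1 s z)) := by
    intro G
    have := fun s => exists_weakStar_limit (U s) (fun v => G.1 (v :: s))
      (Eventually.of_forall fun v => G.2 (v :: s))
    choose G' hG' using this
    exact ⟨⟨G', fun s => (hG' s).1⟩, fun s => (hG' s).2⟩
  choose next hnext using step
  refine ⟨fun s => (next^[k - s.length] ⟨leaf, hleaf⟩).1 s, fun s =>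
    (next^[k - s.length] ⟨leaf, hleaf⟩).2 s, ?_, ?_⟩
  · intro s hs
    simp [hs]
  · intro s hs z
    have e : k - s.length = (k - (s.length + 1)) + 1 := by omega
    simp only [List.length_cons]
    rw [e, Function.iterate_succ_apply']
    exact hnext _ s z

theorem tree_descent {p : List X → Prop} {k : ℕ} {U : List X → Ultrafilter X}
    (hU : ∀ s, ∀ m, s.length + (m + 1) = k → ¬ SphereEventually p (m + 1) s →
        ∀ᶠ v in (U s : Filter X), ¬ SphereEventually p m (v :: s))
    {f : List X → StrongDual ℝ X} (hf1 : ∀ s, ‖f s‖ ≤ 1)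
    (hf : ∀ s, s.length < k → ∀ z, Tendsto (fun v => f (v :: s) z) (U s) (𝓝 (f s z)))
    {R δ : ℝ} (hδ : 0 < δ) (hleaf : ∀ s, s.length = k → ¬ p s →
      R + k * δ < (s.map fun x => |f s x|).sum)
    {V : Ultrafilter (X × ({s : List X // s.length < k} → X))}
    (hV : ∀ s, Tendsto (fun n : X × ({s : List X // s.length < k} → X) => n.2 s) V (U s.1))
    (hVf : ∀ s, Tendsto (fun n : X × ({s : List X // s.length < k} → X) =>
      f (n.2 s :: s.1) n.1 - |f (n.2 s :: s.1) (n.2 s)|) V (𝓝 0)) :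
    ∀ (m : ℕ) (s : List X) (y : X), s.length + m = k → ¬ SphereEventually p m s →
      (s.map fun x => |f s x|).sum - s.length * δ ≤ f s y →
      ¬ IteratedEventually (List.replicate m (V.map Prod.fst)) fun l => ‖y + l.sum‖ ≤ R
  | 0, s, y, hm, hB, hy, h => by
    have h : ‖y + ([] : List X).sum‖ ≤ R := h
    rw [List.sum_nil, add_zero] at h
    have h1 := hleaf s hm hB
    have h2 : f s y ≤ ‖y‖ := (le_abs_self _).trans
      (((f s).le_opNorm y).trans (mul_le_of_le_one_left (norm_nonneg _) (hf1 s)))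
    have h3 : (s.length : ℝ) = k := by exact_mod_cast hm
    rw [h3] at hy
    linarith
  | m + 1, s, y, hm, hB, hy, h => by
    have hs : s.length < k := by omega
    have hlim := hV ⟨s, hs⟩
    have h : ∀ᶠ n in (V : Filter (X × ({s : List X // s.length < k} → X))),
      IteratedEventually (List.replicate m (V.map Prod.fst))
      fun l => ‖y + (n.1 :: l).sum‖ ≤ R := h
    have h1 := hlim.eventually (hU s m hm hB)
    have h2 := hVf ⟨s, hs⟩
    have h3 := (hf s hs y).comp hlim
    have h4 : Tendsto (fun v => (s.map fun x => |f (v :: s) x|).sum) (U s)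
        (𝓝 (s.map fun x => |f s x|).sum) :=
      tendsto_list_sum s fun x _ => (hf s hs x).abs
    have h4 := h4.comp hlim
    have hδ3 : 0 < δ / 3 := by positivity
    obtain ⟨n, hn, hn1, hn2, hn3, hn4⟩ := (h.and (h1.and
      ((h2.eventually (lt_mem_nhds (neg_lt_zero.2 hδ3))).and
      ((h3.eventually (lt_mem_nhds (sub_lt_self _ hδ3))).and
      (h4.eventually (gt_mem_nhds (lt_add_of_pos_right _ hδ3))))))).exists
    simp only [Function.comp_apply] at hn2 hn3 hn4
    refine tree_descent hU hf1 hf hδ hleaf hV hVf m (n.2 ⟨s, hs⟩ :: s) (y + n.1)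
      (by simp only [List.length_cons]; omega) hn1 ?_ (hn.mono _ fun l hl => ?_)
    · rw [List.map_cons, List.sum_cons, map_add, List.length_cons]
      push_cast
      linarith
    · rwa [List.sum_cons, ← add_assoc] at hl

theorem tendsto_sign_smul_weakZero {l : Filter X} (hl : l ≤ weakZero X) (a : X → ℝ) :
    Tendsto (fun v => (SignType.sign (a v) : ℝ) • v) l (weakZero X) := by
  rw [tendsto_weakZero_iff]
  intro φ
  refine squeeze_zero_norm (fun v => ?_)
    (by simpa using (tendsto_of_le_weakZero hl φ).norm : Tendsto (fun v => ‖φ v‖) l (𝓝 0))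
  rw [map_smul, norm_smul]
  refine mul_le_of_le_one_left (norm_nonneg _) ?_
  rcases SignType.sign (a v) with _ | _ | _ <;> simp

theorem BoundedWeaklyNullSums.exists_upper (h : BoundedWeaklyNullSums X) :
    ∃ R : ℝ, ∀ k, SphereEventually (fun t : List X => ∀ φ : StrongDual ℝ X, ‖φ‖ ≤ 1 →
      (t.map fun x => |φ x|).sum ≤ R) k [] := by
  obtain ⟨R₁, hR₁⟩ := h 1
  obtain ⟨R₂, hR₂⟩ := h R₁
  have hR₂0 : 0 ≤ R₂ := by
    have h0 : ‖([] : List X).sum‖ ≤ R₂ := hR₂ [] (by simp)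
    simpa using h0
  refine ⟨R₂ + 1, fun k => ?_⟩
  set p : List X → Prop := fun t => ∀ φ : StrongDual ℝ X, ‖φ‖ ≤ 1 →
      (t.map fun x => |φ x|).sum ≤ R₂ + 1 with hp
  by_contra hB
  obtain ⟨U, hU⟩ := exists_tree_ultrafilter (p := p)
    (fun φ _ => by simp only [List.map_nil, List.sum_nil]; linarith) hB
  have hleaf : ∀ s : List X, ∃ φ : StrongDual ℝ X, ‖φ‖ ≤ 1 ∧
      (¬ p s → R₂ + 1 < (s.map fun x => |φ x|).sum) := by
    intro s
    by_cases hs : p s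
    · exact ⟨0, by simp, fun h => absurd hs h⟩
    · simp only [hp, not_forall, not_le] at hs
      obtain ⟨φ, hφ, hs⟩ := hs
      exact ⟨φ, hφ, fun _ => hs⟩
  choose leaf hleaf1 hleaf using hleaf
  obtain ⟨f, hf1, hfleaf, hf⟩ := exists_tree_functionals U k leaf hleaf1
  classical
  have hU0 : ∀ s, (U s : Filter X) ≤ weakZero X := fun s => (hU s).1.trans inf_le_left
  have hU1 : ∀ s, ∀ᶠ v in (U s : Filter X), ‖v‖ = 1 := fun s =>
    (hU s).1.trans inf_le_right (mem_principal_self _)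
  obtain ⟨V, hV1, hV2, hV3, hV4⟩ := exists_array
    (T := {s : List X // s.length < k}) (U := fun s => U s.1)
    (fun s v => (SignType.sign (f (v :: s.1) v) : ℝ) • v)
    (fun s => tendsto_sign_smul_weakZero (hU0 s.1) _)
    (fun s => by
      filter_upwards [hU1 s.1] with v hv
      rw [norm_smul, hv, mul_one]
      rcases SignType.sign (f (v :: s.1) v) with _ | _ | _ <;> simp)
    (fun s => f s.1) (fun s v => f (v :: s.1)) (fun s => hf s.1 s.2) hR₁
  have hk : (0 : ℝ) < k + 1 := by positivity
  refine tree_descent (p := p) (R := R₂) (δ := 1 / (k + 1)) (fun s => (hU s).2) hf1 hf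
    (by positivity) ?_ hV3 ?_ k [] 0 (by simp) hB (by simp) ?_
  · intro s hs hps
    rw [hfleaf s hs]
    refine lt_of_le_of_lt ?_ (hleaf s hps)
    gcongr
    rw [mul_one_div, div_le_one hk]
    linarith
  · intro s
    refine (hV4 s).congr fun n => ?_
    rw [map_sub, map_smul, smul_eq_mul, sign_mul_self]
  · have := hR₂ (List.replicate k (V.map Prod.fst)) (by
      intro W hW
      obtain rfl := List.eq_of_mem_replicate hW
      exact ⟨hV1, hV2⟩)
    simpa using this

end Tree

section Basis

variable {X : Type*} [NormedAddCommGroup X] [NormedSpace ℝ X]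

/-- The list `t` has a system of functionals of norm at most `2` that is biorthogonal up to `δ`. -/
def AlmostBiorthogonal (δ : ℝ) (t : List X) : Prop :=
  ∃ L : List (X × StrongDual ℝ X), L.map Prod.fst = t ∧
    L.Pairwise (fun p q => |p.2 q.1| ≤ δ ∧ |q.2 p.1| ≤ δ) ∧
    ∀ p ∈ L, ‖p.2‖ ≤ 2 ∧ 1 - δ ≤ p.2 p.1

theorem AlmostBiorthogonal.eventually_cons {δ : ℝ} (hδ : 0 < δ) {s : List X}
    (h : AlmostBiorthogonal δ s) : ∀ᶠ v in sphereFilter X, AlmostBiorthogonal δ (v :: s) := by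
  obtain ⟨L, rfl, hL, hL1⟩ := h
  refine mem_iff_ultrafilter.2 fun U hU => ?_
  have hU0 : (U : Filter X) ≤ weakZero X := hU.trans inf_le_left
  have hU1 : ∀ᶠ v in (U : Filter X), ‖v‖ = 1 := hU.trans inf_le_right (mem_principal_self _)
  choose f hf1 hf using fun v : X => exists_dual_vector'' ℝ v
  obtain ⟨F, hF1, hF⟩ := exists_weakStar_limit U f (Eventually.of_forall hf1)
  have h1 : ∀ᶠ v in (U : Filter X), |F v| < δ := by
    have := (tendsto_of_le_weakZero hU0 F).abs
    rw [abs_zero] at this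
    exact this.eventually (gt_mem_nhds hδ)
  have h2 : ∀ᶠ v in (U : Filter X), ∀ p ∈ {p | p ∈ L}, |p.2 v| < δ := by
    refine (eventually_all_finite L.finite_toSet).2 fun p _ => ?_
    have := (tendsto_of_le_weakZero hU0 p.2).abs
    rw [abs_zero] at this
    exact this.eventually (gt_mem_nhds hδ)
  have h3 : ∀ᶠ v in (U : Filter X), ∀ p ∈ {p | p ∈ L}, |f v p.1 - F p.1| < δ := by
    refine (eventually_all_finite L.finite_toSet).2 fun p _ => ?_
    have := ((hF p.1).sub_const (F p.1)).abs
    rw [sub_self, abs_zero] at this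
    exact this.eventually (gt_mem_nhds hδ)
  change ∀ᶠ v in (U : Filter X), _
  filter_upwards [hU1, h1, h2, h3] with v hv hv1 hv2 hv3
  refine ⟨(v, f v - F) :: L, rfl, List.pairwise_cons.2 ⟨fun p hp => ⟨?_, ?_⟩, hL⟩, ?_⟩
  · simpa using (hv3 p hp).le
  · exact (hv2 p hp).le
  · intro p hp
    rcases List.mem_cons.1 hp with rfl | hp
    · refine ⟨(norm_sub_le _ _).trans (by linarith [hf1 v]), ?_⟩
      have h4 : f v v = 1 := by simpa [hv] using hf v
      change 1 - δ ≤ f v v - F v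
      rw [h4]
      linarith [le_abs_self (F v)]
    · exact hL1 p hp

theorem AlmostBiorthogonal.exists_functionals {δ : ℝ} {k : ℕ} {x : Fin k → X}
    (h : AlmostBiorthogonal δ (List.ofFn x).reverse) :
    ∃ f : Fin k → StrongDual ℝ X, ∀ i, ‖f i‖ ≤ 2 ∧ 1 - δ ≤ f i (x i) ∧
      ∀ j, j ≠ i → |f i (x j)| ≤ δ := by
  obtain ⟨L, hLx, hL, hL1⟩ := h
  have hlen : L.length = k := by simpa using congrArg List.length hLx
  subst hlen
  have hx : ∀ i : Fin L.length, (L.get i.rev).1 = x i := by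
    intro i
    have h1 : (L.map Prod.fst)[i.rev.1]'(by rw [List.length_map]; exact i.rev.2) = (L.get i.rev).1 := by simp
    rw [← h1]
    simp only [hLx, List.getElem_reverse, List.getElem_ofFn]
    congr 1
    ext
    simp
    omega
  refine ⟨fun i => (L.get i.rev).2, fun i => ⟨(hL1 _ (L.get_mem _)).1, ?_, fun j hj => ?_⟩⟩
  · rw [← hx i]
    exact (hL1 _ (L.get_mem _)).2
  · rw [← hx j]
    rw [List.pairwise_iff_get] at hL
    rcases lt_or_gt_of_ne (Fin.rev_injective.ne hj) with hlt | hlt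
    · exact (hL _ _ hlt).2
    · exact (hL _ _ hlt).1

theorem AlmostBiorthogonal.abs_le {δ : ℝ} {k : ℕ} {x : Fin k → X}
    (h : AlmostBiorthogonal δ (List.ofFn x).reverse) (hδ : (k + 1) * δ ≤ 1 / 2) {a : Fin k → ℝ}
    {i : Fin k} (hi : ∀ j, |a j| ≤ |a i|) : |a i| ≤ 4 * ‖∑ j, a j • x j‖ := by
  obtain ⟨f, hf⟩ := h.exists_functionals
  obtain ⟨hf1, hf2, hf3⟩ := hf i
  have hsum : f i (∑ j, a j • x j) = a i * f i (x i) + ∑ j ∈ univ.erase i, a j * f i (x j) := by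
    rw [map_sum, ← Finset.add_sum_erase _ _ (Finset.mem_univ i)]
    simp only [map_smul, smul_eq_mul]
  have hδ0 : 0 ≤ δ ∨ k = 1 := by
    by_cases hk : ∃ j, j ≠ i
    · obtain ⟨j, hj⟩ := hk
      exact Or.inl ((abs_nonneg _).trans (hf3 j hj))
    · push Not at hk
      right
      have : Subsingleton (Fin k) := ⟨fun a b => (hk a).trans (hk b).symm⟩
      have h1 := Fin.subsingleton_iff_le_one.1 this
      have := i.2
      omega
  have hcross : |∑ j ∈ univ.erase i, a j * f i (x j)| ≤ (k - 1) * (|a i| * δ) := by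
    refine (Finset.abs_sum_le_sum_abs _ _).trans ?_
    have : ∀ j ∈ univ.erase i, |a j * f i (x j)| ≤ |a i| * δ := by
      intro j hj
      rw [abs_mul]
      exact mul_le_mul (hi j) (hf3 j (Finset.ne_of_mem_erase hj)) (abs_nonneg _) (abs_nonneg _)
    refine (Finset.sum_le_card_nsmul _ _ _ this).trans (le_of_eq ?_)
    rw [Finset.card_erase_of_mem (Finset.mem_univ i), Finset.card_univ, Fintype.card_fin,
      nsmul_eq_mul, Nat.cast_sub (by have := i.2; omega)]
    simp
  have hmain : |a i| * (1 - δ) ≤ |a i * f i (x i)| := by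
    rw [abs_mul]
    exact mul_le_mul_of_nonneg_left (hf2.trans (le_abs_self _)) (abs_nonneg _)
  have hle : |f i (∑ j, a j • x j)| ≤ 2 * ‖∑ j, a j • x j‖ :=
    ((f i).le_opNorm _).trans (mul_le_mul_of_nonneg_right hf1 (norm_nonneg _))
  have htri : |a i * f i (x i)| ≤
      |f i (∑ j, a j • x j)| + |∑ j ∈ univ.erase i, a j * f i (x j)| := by
    rw [hsum]
    exact le_of_eq_of_le (congrArg _ (add_sub_cancel_right _ _).symm) (abs_sub _ _)
  have hkδ : k * δ ≤ 1 / 2 := by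
    rcases hδ0 with h0 | rfl
    · linarith
    · norm_num at hδ ⊢
      linarith
  have := mul_le_mul_of_nonneg_left hkδ (abs_nonneg (a i))
  linarith

theorem norm_sum_smul_le {R M : ℝ} {k : ℕ} {x : Fin k → X} {a : Fin k → ℝ}
    (h : ∀ φ : StrongDual ℝ X, ‖φ‖ ≤ 1 → ((List.ofFn x).reverse.map fun x => |φ x|).sum ≤ R)
    (hM : 0 ≤ M) (ha : ∀ i, |a i| ≤ M) : ‖∑ i, a i • x i‖ ≤ R * M := by
  obtain ⟨φ, hφ, hφx⟩ := exists_dual_vector'' ℝ (∑ i, a i • x i)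
  have h1 := h φ hφ
  rw [List.map_reverse, List.sum_reverse, List.map_ofFn, List.sum_ofFn] at h1
  have h2 : ‖∑ i, a i • x i‖ = φ (∑ i, a i • x i) := by simpa using hφx.symm
  rw [h2, map_sum]
  calc ∑ i, φ (a i • x i) ≤ ∑ i, |φ (x i)| * M := by
        refine Finset.sum_le_sum fun i _ => ?_
        rw [map_smul, smul_eq_mul, mul_comm |φ (x i)|]
        refine (le_abs_self _).trans ?_
        rw [abs_mul]
        exact mul_le_mul_of_nonneg_right (ha i) (abs_nonneg _)
    _ = (∑ i, |φ (x i)|) * M := by rw [Finset.sum_mul]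
    _ ≤ R * M := mul_le_mul_of_nonneg_right h1 hM

theorem equivLinftyBasis_of_almostBiorthogonal {R D δ : ℝ} {k : ℕ} {x : Fin k → X} (hR : 0 < R)
    (hD : 4 * R ≤ D) (hδ : (k + 1) * δ ≤ 1 / 2)
    (h : ∀ φ : StrongDual ℝ X, ‖φ‖ ≤ 1 → ((List.ofFn x).reverse.map fun x => |φ x|).sum ≤ R)
    (h' : AlmostBiorthogonal δ (List.ofFn x).reverse) : EquivLinftyBasis D x := by
  refine ⟨4, R, by norm_num, hR, hD, fun a => ?_⟩
  rcases Nat.eq_zero_or_pos k with rfl | hk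
  · simp
  have : Nonempty (Fin k) := ⟨⟨0, hk⟩⟩
  obtain ⟨i, hi⟩ := exists_eq_ciSup_of_finite (f := fun i => |a i|)
  have hle : ∀ j, |a j| ≤ |a i| := by
    intro j
    rw [hi]
    exact le_ciSup (f := fun i => |a i|) (Set.finite_range _).bddAbove j
  rw [← hi]
  refine ⟨?_, norm_sum_smul_le h (abs_nonneg _) hle⟩
  have := h'.abs_le hδ hle
  linarith

theorem SphereEventually.exists_finCodimClosed {p : List X → Prop} {m : ℕ} {s : List X}
    (h : SphereEventually p (m + 1) s) :
    ∃ Z : Submodule ℝ X, FinCodimClosed Z ∧ ∀ v ∈ Z, ‖v‖ = 1 → SphereEventually p m (v :: s) :=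
  exists_finCodimClosed_of_eventually_weakZero (eventually_inf_principal.1 h)

theorem finCodimClosed_top : FinCodimClosed (⊤ : Submodule ℝ X) :=
  ⟨isClosed_univ, inferInstance⟩

theorem SphereEventually.exists_strategy {p : List X → Prop} {k : ℕ}
    (h : SphereEventually p k []) :
    ∃ σ : (Σ i : Fin k, (Fin i.1 → X)) → Submodule ℝ X, (∀ q, FinCodimClosed (σ q)) ∧
      ∀ x : Fin k → X,
        (∀ i : Fin k, ‖x i‖ = 1 ∧ x i ∈ σ ⟨i, fun j => x ⟨j.1, j.2.trans i.2⟩⟩) →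
        p (List.ofFn x).reverse := by
  have key : ∀ q : Σ i : Fin k, (Fin i.1 → X), ∃ Z : Submodule ℝ X, FinCodimClosed Z ∧
      (SphereEventually p (k - q.1) (List.ofFn q.2).reverse → ∀ v ∈ Z, ‖v‖ = 1 →
        SphereEventually p (k - (q.1 + 1)) (v :: (List.ofFn q.2).reverse)) := by
    intro q
    by_cases hq : SphereEventually p (k - q.1) (List.ofFn q.2).reverse
    · have e : k - q.1 = (k - (q.1 + 1)) + 1 := by have := q.1.2; omega
      rw [e] at hq
      obtain ⟨Z, hZ, hZp⟩ := hq.exists_finCodimClosed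
      exact ⟨Z, hZ, fun _ => hZp⟩
    · exact ⟨⊤, finCodimClosed_top, fun h => absurd h hq⟩
  choose σ hσ hσp using key
  refine ⟨σ, hσ, fun x hx => ?_⟩
  have main : ∀ (i : ℕ) (hi : i ≤ k),
      SphereEventually p (k - i) (List.ofFn fun j : Fin i => x ⟨j, j.2.trans_le hi⟩).reverse := by
    intro i
    induction i with
    | zero => exact fun _ => by simpa using h
    | succ i ih =>
      intro hi
      have := hσp ⟨⟨i, hi⟩, fun j => x ⟨j.1, j.2.trans hi⟩⟩ (ih (Nat.le_of_succ_le hi)) _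
        (hx ⟨i, hi⟩).2 (hx ⟨i, hi⟩).1
      rw [List.ofFn_succ', List.concat_eq_append, List.reverse_append]
      exact this
  simpa [SphereEventually] using main k le_rfl

theorem BoundedWeaklyNullSums.asymptoticC0 (h : BoundedWeaklyNullSums X) : AsymptoticC0 X := by
  obtain ⟨R, hR⟩ := h.exists_upper
  refine ⟨4 * max R 1, by linarith [le_max_right R 1], fun k ε hε => ?_⟩
  have hk : (0 : ℝ) < k + 1 := by positivity
  have hδ : (0 : ℝ) < 1 / 2 / (k + 1) := by positivity
  have h0 : AlmostBiorthogonal (1 / 2 / (k + 1)) ([] : List X) := ⟨[], by simp⟩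
  obtain ⟨σ, hσ, hx⟩ := ((hR k).and
    (SphereEventually.of_forall_cons (fun _ hs => hs.eventually_cons hδ) h0)).exists_strategy
  refine ⟨σ, hσ, fun x hxσ => ?_⟩
  obtain ⟨h1, h2⟩ := hx x hxσ
  exact equivLinftyBasis_of_almostBiorthogonal (lt_max_of_lt_right one_pos)
    (by linarith) (mul_div_cancel₀ _ hk.ne').le
    (fun φ hφ => (h1 φ hφ).trans (le_max_left _ _)) h2

end Basis

/-- Theorem A: if `Y` is a reflexive asymptotic-`c₀` Banach space and the
Banach space `X` coarsely embeds into `Y`, then `X` is reflexive and asymptotic-`c₀`. -/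
theorem statement_7 {X Y : Type*} [NormedAddCommGroup X] [NormedSpace ℝ X] [CompleteSpace X]
    [NormedAddCommGroup Y] [NormedSpace ℝ Y] [CompleteSpace Y]
    (hYrefl : IsReflexiveSpace Y) (hYc0 : AsymptoticC0 Y)
    (hemb : ∃ g : X → Y, CoarseEmbedding g) :
    IsReflexiveSpace X ∧ AsymptoticC0 X := by
  obtain ⟨g, hg⟩ := hemb
  exact ⟨hg.isReflexiveSpace hYrefl hYc0, (hg.boundedWeaklyNullSums hYrefl hYc0).asymptoticC0⟩
end

section
/- Let X be a reflexive Banach space. Then there exists a separable closed subspace Y of X such that for every k ∈ ℕ the k-th asymptotic structures coincide: {X}_k = {Y}_k, i.e. for every k-dimensional space E with normalized monotone basis (e_j)_{j=1}^k, (e_j)_{j=1}^k belongs to {X}_k if and only if it belongs to {Y}_k. -/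
open Finset Filter

/-- `(x₁,...,x_k)` is `D`-equivalent to `(e₁,...,e_k)`. -/
def SeqEquivTo (D : ℝ) {Z E : Type*} [NormedAddCommGroup Z] [NormedSpace ℝ Z]
    [NormedAddCommGroup E] [NormedSpace ℝ E] {k : ℕ} (x : Fin k → Z) (e : Fin k → E) : Prop :=
  ∃ A B : ℝ, 0 < A ∧ 0 < B ∧ A * B ≤ D ∧
    ∀ a : Fin k → ℝ,
      (1 / A) * ‖∑ j, a j • e j‖ ≤ ‖∑ j, a j • x j‖ ∧
      ‖∑ j, a j • x j‖ ≤ B * ‖∑ j, a j • e j‖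

/-- `(e₁,...,e_k)` is a normalized monotone basis of the `k`-dimensional space `E`. -/
def IsNormalizedMonotoneBasis {E : Type*} [NormedAddCommGroup E] [NormedSpace ℝ E]
    {k : ℕ} (e : Fin k → E) : Prop :=
  LinearIndependent ℝ e ∧ Submodule.span ℝ (Set.range e) = ⊤ ∧ (∀ j, ‖e j‖ = 1) ∧
  ∀ (a : Fin k → ℝ) (i i' : ℕ), i ≤ i' →
    ‖∑ j ∈ Finset.univ.filter (fun j : Fin k => (j : ℕ) < i), a j • e j‖ ≤
    ‖∑ j ∈ Finset.univ.filter (fun j : Fin k => (j : ℕ) < i'), a j • e j‖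

/-- `(e₁,...,e_k)` belongs to the `k`-th asymptotic structure `{Z}_k`: for every `ε > 0`
there is a tree family `x(Y₁,...,Y_l)` (formally, a map on `k`-tuples of subspaces whose
`l`-th value only depends on the first `l` subspaces) of unit vectors with
`x(Y₁,...,Y_l) ∈ S_{Y_l}`, such that for every choice of closed finite-codimensional
subspaces `Y₁,...,Y_k` the branch `(x(Y₁,...,Y_l))_{l=1}^k` is `(1+ε)`-equivalent to
`(e₁,...,e_k)`. -/
def InAsymStruct (Z : Type*) [NormedAddCommGroup Z] [NormedSpace ℝ Z]
    {E : Type*} [NormedAddCommGroup E] [NormedSpace ℝ E] {k : ℕ} (e : Fin k → E) : Prop :=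
  ∀ ε : ℝ, 0 < ε →
    ∃ x : (Fin k → Submodule ℝ Z) → Fin k → Z,
      (∀ Y Y' : Fin k → Submodule ℝ Z, ∀ l : Fin k,
        (∀ j : Fin k, j ≤ l → Y j = Y' j) → x Y l = x Y' l) ∧
      ∀ Y : Fin k → Submodule ℝ Z, (∀ j, FinCodimClosed (Y j)) →
        (∀ l, x Y l ∈ Y l ∧ ‖x Y l‖ = 1) ∧ SeqEquivTo (1 + ε) (x Y) e


section AsymptoticGame

variable {X : Type*}

/-- The second player wins the `k`-round game in which the first player names a set of the family
`𝒜`, the second player answers with a point of it, and the resulting sequence has to satisfy `P`. -/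
def GameWin (𝒜 : Set (Set X)) : (k : ℕ) → ((Fin k → X) → Prop) → Prop
  | 0, P => P Fin.elim0
  | k + 1, P => ∀ A ∈ 𝒜, ∃ x ∈ A, GameWin 𝒜 k fun s => P (Fin.cons x s)

theorem GameWin.mono {𝒜 ℬ : Set (Set X)} (h : ∀ B ∈ ℬ, ∃ A ∈ 𝒜, A ⊆ B) {k : ℕ}
    {P Q : (Fin k → X) → Prop} (hPQ : ∀ s, P s → Q s) (hP : GameWin 𝒜 k P) : GameWin ℬ k Q := by
  induction k with
  | zero => exact hPQ _ hP
  | succ k ih =>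
    intro B hB
    obtain ⟨A, hA, hAB⟩ := h B hB
    obtain ⟨x, hx, hw⟩ := hP A hA
    exact ⟨x, hAB hx, ih (fun s => hPQ _) hw⟩

variable [NormedAddCommGroup X] [NormedSpace ℝ X]

/-- The unit spheres of the closed finite-codimensional subspaces. -/
def finCodimSpheres (X : Type*) [NormedAddCommGroup X] [NormedSpace ℝ X] : Set (Set X) :=
  {A | ∃ Y : Submodule ℝ X, FinCodimClosed Y ∧ A = {x | x ∈ Y ∧ ‖x‖ = 1}}

/-- The traces on `D ∩ S_X` of the basic weak neighbourhoods of `0`. -/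
def weakNhdSpheres (D : Set X) : Set (Set X) :=
  {A | ∃ (n : ℕ) (f : Fin n → StrongDual ℝ X) (ε : ℝ), 0 < ε ∧
    A = {x | x ∈ D ∧ ‖x‖ = 1 ∧ ∀ i, |f i x| < ε}}

theorem gameWin_weakNhdSpheres_mono {D D' : Set X} (h : D ⊆ D') {k : ℕ}
    {P : (Fin k → X) → Prop} (hP : GameWin (weakNhdSpheres D) k P) :
    GameWin (weakNhdSpheres D') k P := by
  refine hP.mono ?_ fun _ => id
  rintro _ ⟨n, f, ε, hε, rfl⟩
  exact ⟨_, ⟨n, f, ε, hε, rfl⟩, fun x hx => ⟨h hx.1, hx.2⟩⟩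

theorem finCodimClosed_ker_pi {n : ℕ} (f : Fin n → StrongDual ℝ X) :
    FinCodimClosed (ContinuousLinearMap.pi f : X →L[ℝ] (Fin n → ℝ)).ker := by
  refine ⟨(ContinuousLinearMap.pi f).isClosed_ker, ?_⟩
  exact Module.Finite.equiv
    (LinearMap.quotKerEquivRange (ContinuousLinearMap.pi f : X →L[ℝ] (Fin n → ℝ)).toLinearMap).symm

/-- Countable tightness of the weak topology at `0`. -/
theorem exists_countable_weak_closure (A : Set X)
    (hA : ∀ (n : ℕ) (f : Fin n → StrongDual ℝ X) (ε : ℝ), 0 < ε → ∃ x ∈ A, ∀ i, |f i x| < ε) :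
    ∃ C ⊆ A, C.Countable ∧
      ∀ (n : ℕ) (f : Fin n → StrongDual ℝ X) (ε : ℝ), 0 < ε → ∃ x ∈ C, ∀ i, |f i x| < ε := by
  have key : ∀ q : ℕ × ℕ × ℕ, ∃ C ⊆ A, C.Finite ∧ ∀ f : Fin q.1 → StrongDual ℝ X,
      (∀ i, ‖f i‖ ≤ q.2.1) → ∃ x ∈ C, ∀ i, |f i x| < 1 / ((q.2.2 : ℝ) + 1) := by
    rintro ⟨n, R, m⟩
    have hK : IsCompact (Set.univ.pi fun _ : Fin n =>
        WeakDual.toStrongDual ⁻¹' Metric.closedBall (0 : StrongDual ℝ X) R) :=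
      isCompact_univ_pi fun _ => WeakDual.isCompact_closedBall _ _
    obtain ⟨C, hCA, hC, hcov⟩ := hK.elim_finite_subcover_image (b := A)
      (c := fun x => {f : Fin n → WeakDual ℝ X | ∀ i, |f i x| < 1 / ((m : ℝ) + 1)})
      (fun x _ => by
        simp only [Set.ofPred_forall]
        refine isOpen_iInter_of_finite fun i => isOpen_lt ?_ continuous_const
        exact ((WeakDual.eval_continuous x).comp (continuous_apply i)).abs)
      (fun f _ => by
        obtain ⟨x, hx, h⟩ := hA n (fun i => WeakDual.toStrongDual (f i)) (1 / ((m : ℝ) + 1))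
          (by positivity)
        exact Set.mem_iUnion₂.2 ⟨x, hx, h⟩)
    refine ⟨C, hCA, hC, fun f hf => ?_⟩
    have := hcov (a := fun i => StrongDual.toWeakDual (f i)) (fun i _ => by simpa using hf i)
    obtain ⟨x, hx, h⟩ := Set.mem_iUnion₂.1 this
    exact ⟨x, hx, h⟩
  choose C hCA hC h using key
  refine ⟨⋃ q, C q, Set.iUnion_subset hCA, Set.countable_iUnion fun q => (hC q).countable, ?_⟩
  intro n f ε hε
  obtain ⟨R, hR⟩ := exists_nat_ge (∑ i, ‖f i‖)
  obtain ⟨m, hm⟩ := exists_nat_one_div_lt hε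
  obtain ⟨x, hx, hfx⟩ := h (n, R, m) f fun i =>
    (Finset.single_le_sum (fun j _ => norm_nonneg (f j)) (Finset.mem_univ i)).trans hR
  exact ⟨x, Set.mem_iUnion.2 ⟨_, hx⟩, fun i => (hfx i).trans hm⟩

theorem exists_countable_gameWin {k : ℕ} {P : (Fin k → X) → Prop}
    (hP : GameWin (finCodimSpheres X) k P) :
    ∃ D : Set X, D.Countable ∧ GameWin (weakNhdSpheres D) k P := by
  induction k with
  | zero => exact ⟨∅, Set.countable_empty, hP⟩
  | succ k ih =>
    obtain ⟨C, hCA, hC, h⟩ := exists_countable_weak_closure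
      {x : X | ‖x‖ = 1 ∧ GameWin (finCodimSpheres X) k fun s => P (Fin.cons x s)}
      (fun n f ε hε => by
        obtain ⟨x, ⟨hx, hx1⟩, hw⟩ := hP _ ⟨_, finCodimClosed_ker_pi f, rfl⟩
        refine ⟨x, ⟨hx1, hw⟩, fun i => ?_⟩
        have : f i x = 0 := congrFun hx i
        simpa [this] using hε)
    choose! D hD hw using fun x (hx : x ∈ C) => ih (hCA hx).2
    refine ⟨C ∪ ⋃ x ∈ C, D x, hC.union (hC.biUnion hD), ?_⟩
    rintro _ ⟨n, f, ε, hε, rfl⟩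
    obtain ⟨x, hx, hfx⟩ := h n f ε hε
    exact ⟨x, ⟨Or.inl hx, (hCA hx).1, hfx⟩, gameWin_weakNhdSpheres_mono
      ((Set.subset_biUnion_of_mem hx).trans Set.subset_union_right) (hw x hx)⟩

theorem exists_near_unit_vector {M : Type*} [NormedAddCommGroup M] [NormedSpace ℝ M]
    {W : Submodule ℝ M} {x : M} (hx : ‖x‖ = 1) {δ : ℝ} (hδ : δ < 1)
    (h : ‖(Submodule.Quotient.mk x : M ⧸ W)‖ < δ) :
    ∃ w ∈ W, ‖w‖ = 1 ∧ ‖x - w‖ ≤ 2 * δ := by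
  obtain ⟨m, hm, hmδ⟩ := Submodule.Quotient.norm_mk_lt (Submodule.Quotient.mk x : M ⧸ W)
    (sub_pos.2 h)
  rw [add_sub_cancel] at hmδ
  have hw : x - m ∈ W := (Submodule.Quotient.eq W).1 hm.symm
  have h1 : |1 - ‖x - m‖| ≤ ‖m‖ := by simpa [hx] using abs_norm_sub_norm_le x (x - m)
  have hpos : 0 < ‖x - m‖ := by linarith [(abs_le.1 h1).2]
  refine ⟨‖x - m‖⁻¹ • (x - m), W.smul_mem _ hw, ?_, ?_⟩
  · rw [norm_smul, norm_inv, norm_norm, inv_mul_cancel₀ hpos.ne']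
  · have h2 : ‖(x - m) - ‖x - m‖⁻¹ • (x - m)‖ = |1 - ‖x - m‖| := by
      have : (x - m) - ‖x - m‖⁻¹ • (x - m) = (1 - ‖x - m‖⁻¹) • (x - m) := by
        rw [sub_smul, one_smul]
      rw [this, norm_smul, Real.norm_eq_abs, ← abs_of_pos hpos, ← abs_mul, abs_of_pos hpos,
        sub_mul, inv_mul_cancel₀ hpos.ne', one_mul, abs_sub_comm]
    calc ‖x - ‖x - m‖⁻¹ • (x - m)‖ = ‖m + ((x - m) - ‖x - m‖⁻¹ • (x - m))‖ := by congr 1; abel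
      _ ≤ ‖m‖ + |1 - ‖x - m‖| := h2 ▸ norm_add_le _ _
      _ ≤ 2 * δ := by linarith

theorem exists_functionals_near {Y : Submodule ℝ X} {W : Submodule ℝ Y} (hW : FinCodimClosed W)
    {δ : ℝ} (hδ : 0 < δ) :
    ∃ (n : ℕ) (f : Fin n → StrongDual ℝ X) (ε : ℝ), 0 < ε ∧
      ∀ x : Y, ‖x‖ = 1 → (∀ i, |f i x| < ε) → ∃ w ∈ W, ‖w‖ = 1 ∧ ‖x - w‖ ≤ δ := by
  have : IsClosed (W : Set Y) := hW.1
  have := hW.2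
  let φ : (Y ⧸ W) ≃L[ℝ] (Fin (Module.finrank ℝ (Y ⧸ W)) → ℝ) :=
    ContinuousLinearEquiv.ofFinrankEq (by simp)
  choose f hf _ using fun i => exists_extension_norm_eq Y
    ((ContinuousLinearMap.proj (R := ℝ) (φ := fun _ => ℝ) i).comp
      ((φ : (Y ⧸ W) →L[ℝ] (Fin (Module.finrank ℝ (Y ⧸ W)) → ℝ)).comp W.mkQL))
  set η : ℝ := min (δ / 2) (1 / 2)
  have hη : 0 < η := by positivity
  let ψ : (Fin (Module.finrank ℝ (Y ⧸ W)) → ℝ) →L[ℝ] (Y ⧸ W) := φ.symm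
  set C : ℝ := ‖ψ‖ + 1 with hC
  have hCpos : 0 < C := by positivity
  refine ⟨_, f, η / C, by positivity, fun x hx hfx => ?_⟩
  have hq : ‖(Submodule.Quotient.mk x : Y ⧸ W)‖ < η := by
    have h1 : ‖φ (Submodule.Quotient.mk x)‖ < η / C := by
      refine (pi_norm_lt_iff (by positivity)).2 fun i => ?_
      have := hfx i
      rw [hf i x] at this
      exact this
    calc ‖(Submodule.Quotient.mk x : Y ⧸ W)‖
        = ‖ψ (φ (Submodule.Quotient.mk x))‖ := by simp [ψ]
      _ ≤ ‖ψ‖ * ‖φ (Submodule.Quotient.mk x)‖ :=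
        ContinuousLinearMap.le_opNorm _ _
      _ ≤ C * ‖φ (Submodule.Quotient.mk x)‖ := by gcongr; simp [hC]
      _ < C * (η / C) := by gcongr
      _ = η := by field_simp
  obtain ⟨w, hw, hw1, hwx⟩ := exists_near_unit_vector hx
    ((min_le_right _ _).trans_lt (by norm_num)) hq
  exact ⟨w, hw, hw1, by linarith [min_le_left (δ / 2) (1 / 2 : ℝ)]⟩

theorem gameWin_subspace_of_weakNhdSpheres {D : Set X} {Y : Submodule ℝ X} (hDY : D ⊆ Y)
    {δ : ℝ} (hδ : 0 < δ) {k : ℕ} {P : (Fin k → X) → Prop}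
    (hP : GameWin (weakNhdSpheres D) k P) :
    GameWin (finCodimSpheres Y) k fun t => ∃ s, P s ∧ ∀ j, ‖s j - t j‖ ≤ δ := by
  induction k with
  | zero => exact ⟨_, hP, fun j => j.elim0⟩
  | succ k ih =>
    rintro _ ⟨W, hW, rfl⟩
    obtain ⟨n, f, ε, hε, h⟩ := exists_functionals_near hW hδ
    obtain ⟨x, ⟨hxD, hx1, hfx⟩, hw⟩ := hP _ ⟨n, f, ε, hε, rfl⟩
    obtain ⟨w, hwW, hw1, hxw⟩ := h ⟨x, hDY hxD⟩ hx1 hfx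
    refine ⟨w, ⟨hwW, hw1⟩, (ih hw).mono (fun A hA => ⟨A, hA, subset_rfl⟩) ?_⟩
    rintro t ⟨s, hs, hst⟩
    refine ⟨Fin.cons x s, hs, fun j => ?_⟩
    cases j using Fin.cases with
    | zero => simpa using hxw
    | succ j => simpa using hst j

theorem gameWin_of_strategy {k : ℕ} {P : (Fin k → X) → Prop}
    (x : (Fin k → Submodule ℝ X) → Fin k → X)
    (hcausal : ∀ Y Y' : Fin k → Submodule ℝ X, ∀ l : Fin k,
      (∀ j : Fin k, j ≤ l → Y j = Y' j) → x Y l = x Y' l)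
    (hx : ∀ Y : Fin k → Submodule ℝ X, (∀ j, FinCodimClosed (Y j)) →
      (∀ l, x Y l ∈ Y l ∧ ‖x Y l‖ = 1) ∧ P (x Y)) :
    GameWin (finCodimSpheres X) k P := by
  induction k with
  | zero =>
    have := (hx (fun j => j.elim0) fun j => j.elim0).2
    rwa [Subsingleton.elim (x _) Fin.elim0] at this
  | succ k ih =>
    rintro _ ⟨W, hW, rfl⟩
    have htop : FinCodimClosed (⊤ : Submodule ℝ X) := ⟨isClosed_univ, inferInstance⟩
    have h0 : ∀ Y, x (Fin.cons W Y) 0 = x (Fin.cons W fun _ => ⊤) 0 := fun Y =>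
      hcausal _ _ _ fun j hj => by
        obtain rfl : j = 0 := Fin.le_zero_iff.1 hj
        simp
    have hcons : ∀ Y : Fin k → Submodule ℝ X, (∀ j, FinCodimClosed (Y j)) →
        ∀ j, FinCodimClosed ((Fin.cons W Y : Fin (k + 1) → Submodule ℝ X) j) := fun Y hY j => by
      cases j using Fin.cases with
      | zero => exact hW
      | succ j => exact hY j
    refine ⟨x (Fin.cons W fun _ => ⊤) 0, (hx _ (hcons _ fun _ => htop)).1 0,
      ih (fun Y l => x (Fin.cons W Y) l.succ) (fun Y Y' l h => hcausal _ _ _ fun j hj => ?_)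
        fun Y hY => ⟨fun l => (hx _ (hcons Y hY)).1 l.succ, ?_⟩⟩
    · cases j using Fin.cases with
      | zero => rfl
      | succ j => exact h j (Fin.succ_le_succ_iff.1 hj)
    · have := (hx _ (hcons Y hY)).2
      rwa [← Fin.cons_self_tail (x (Fin.cons W Y)), h0 Y] at this

theorem exists_strategy_of_gameWin {k : ℕ} {P : (Fin k → X) → Prop}
    (hP : GameWin (finCodimSpheres X) k P) :
    ∃ x : (Fin k → Submodule ℝ X) → Fin k → X,
      (∀ Y Y' : Fin k → Submodule ℝ X, ∀ l : Fin k,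
        (∀ j : Fin k, j ≤ l → Y j = Y' j) → x Y l = x Y' l) ∧
      ∀ Y : Fin k → Submodule ℝ X, (∀ j, FinCodimClosed (Y j)) →
        (∀ l, x Y l ∈ Y l ∧ ‖x Y l‖ = 1) ∧ P (x Y) := by
  induction k with
  | zero => exact ⟨fun _ => Fin.elim0, fun _ _ l => l.elim0, fun _ _ => ⟨fun l => l.elim0, hP⟩⟩
  | succ k ih =>
    have : ∀ W : Submodule ℝ X, FinCodimClosed W → ∃ x : X, (x ∈ W ∧ ‖x‖ = 1) ∧ _ :=
      fun W hW => hP _ ⟨W, hW, rfl⟩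
    choose! x₀ hx₀ hw using this
    choose! x hcausal hx using fun W hW => ih (hw W hW)
    classical
    refine ⟨fun Y => if FinCodimClosed (Y 0) then Fin.cons (x₀ (Y 0)) (x (Y 0) (Fin.tail Y)) else 0,
      fun Y Y' l h => ?_, fun Y hY => ?_⟩
    · dsimp only
      rw [← h 0 (Fin.zero_le l)]
      split_ifs with hY
      · cases l using Fin.cases with
        | zero => rfl
        | succ l =>
          exact hcausal _ hY _ _ _ fun j hj => h j.succ (Fin.succ_le_succ_iff.2 hj)
      · rfl
    · dsimp only
      rw [if_pos (hY 0)]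
      have := hx (Y 0) (hY 0) (Fin.tail Y) fun j => hY j.succ
      refine ⟨fun l => ?_, this.2⟩
      cases l using Fin.cases with
      | zero => exact hx₀ _ (hY 0)
      | succ l => exact this.1 l

variable {E : Type*} [NormedAddCommGroup E] [NormedSpace ℝ E]

/-- The norm that a finite sequence induces on coefficients, restricted to the unit ball of
`ℓ_∞^k`. -/
def coeffNorm {k : ℕ} (s : Fin k → X) : C(Metric.closedBall (0 : Fin k → ℝ) 1, ℝ) where
  toFun a := ‖∑ j, (a : Fin k → ℝ) j • s j‖
  continuous_toFun := (continuous_finsetSum _ fun j _ =>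
    ((continuous_apply j).comp continuous_subtype_val).smul continuous_const).norm

theorem dist_coeffNorm_le {k : ℕ} {s : Fin k → X} {t : Fin k → E} {δ : ℝ} (hδ : 0 ≤ δ)
    (h : ∀ a : Fin k → ℝ, ‖a‖ ≤ 1 → |‖∑ j, a j • s j‖ - ‖∑ j, a j • t j‖| ≤ δ) :
    dist (coeffNorm s) (coeffNorm t) ≤ δ :=
  (ContinuousMap.dist_le hδ).2 fun a => h a (mem_closedBall_zero_iff.1 a.2)

theorem abs_norm_sum_sub_le_dist_coeffNorm {k : ℕ} (s : Fin k → X) (t : Fin k → E)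
    (a : Fin k → ℝ) :
    |‖∑ j, a j • s j‖ - ‖∑ j, a j • t j‖| ≤ dist (coeffNorm s) (coeffNorm t) * ‖a‖ := by
  rcases eq_or_ne a 0 with rfl | ha
  · simp
  have hpos : 0 < ‖a‖ := norm_pos_iff.2 ha
  have hmem : ‖a‖⁻¹ • a ∈ Metric.closedBall (0 : Fin k → ℝ) 1 := by
    simp [norm_smul, hpos.ne']
  have h := ContinuousMap.dist_apply_le_dist (f := coeffNorm s) (g := coeffNorm t) ⟨_, hmem⟩
  have h' : |‖∑ j, (‖a‖⁻¹ • a) j • s j‖ - ‖∑ j, (‖a‖⁻¹ • a) j • t j‖|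
      ≤ dist (coeffNorm s) (coeffNorm t) := h
  simp only [Pi.smul_apply, smul_assoc, ← Finset.smul_sum, norm_smul, norm_inv, norm_norm,
    ← mul_sub, abs_mul, abs_inv, abs_norm] at h'
  rwa [inv_mul_le_iff₀ hpos, mul_comm] at h'

theorem dist_coeffNorm_le_of_norm_sub_le {k : ℕ} {s t : Fin k → X} {δ : ℝ} (hδ : 0 ≤ δ)
    (h : ∀ j, ‖s j - t j‖ ≤ δ) : dist (coeffNorm s) (coeffNorm t) ≤ k * δ := by
  refine dist_coeffNorm_le (by positivity) fun a ha => (abs_norm_sub_norm_le _ _).trans ?_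
  rw [← Finset.sum_sub_distrib]
  calc ‖∑ j, (a j • s j - a j • t j)‖ ≤ ∑ _j : Fin k, δ := norm_sum_le_of_le _ fun j _ => by
        rw [← smul_sub, norm_smul]
        exact (mul_le_of_le_one_left (norm_nonneg _) ((norm_le_pi_norm a j).trans ha)).trans (h j)
      _ = k * δ := by simp

theorem norm_sum_smul_coe {Y : Submodule ℝ X} {k : ℕ} (a : Fin k → ℝ) (t : Fin k → Y) :
    ‖∑ j, a j • (t j : X)‖ = ‖∑ j, a j • t j‖ := by
  rw [Submodule.coe_norm]
  simp

theorem coeffNorm_subspace {Y : Submodule ℝ X} {k : ℕ} (t : Fin k → Y) :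
    coeffNorm (fun j => (t j : X)) = coeffNorm t := by
  ext a
  exact norm_sum_smul_coe _ t

theorem SeqEquivTo.dist_coeffNorm_le {k : ℕ} {s : Fin k → X} {e : Fin k → E}
    (hs : ∀ j, ‖s j‖ = 1) (he : ∀ j, ‖e j‖ = 1) {η : ℝ} (hη : 0 ≤ η)
    (h : SeqEquivTo (1 + η) s e) : dist (coeffNorm s) (coeffNorm e) ≤ η * k := by
  refine _root_.dist_coeffNorm_le (by positivity) fun a ha => ?_
  rcases Nat.eq_zero_or_pos k with rfl | hk
  · simp
  obtain ⟨A, B, hA, hB, hAB, h⟩ := h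
  have h0 := h (Pi.single ⟨0, hk⟩ 1)
  simp only [Pi.single_apply, ite_smul, one_smul, zero_smul, Finset.sum_ite_eq',
    Finset.mem_univ, if_true, hs, he, mul_one] at h0
  have hA1 : 1 ≤ A := by simpa using (div_le_iff₀ hA).1 h0.1
  have hA' : A ≤ 1 + η := by nlinarith
  have hB' : B ≤ 1 + η := by nlinarith
  obtain ⟨h1, h2⟩ := h a
  have hpk : ‖∑ j, a j • e j‖ ≤ k := by
    calc ‖∑ j, a j • e j‖ ≤ ∑ _j : Fin k, (1 : ℝ) := norm_sum_le_of_le _ fun j _ => by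
          rw [norm_smul, he, mul_one]
          exact (norm_le_pi_norm a j).trans ha
      _ = k := by simp
  rw [one_div, inv_mul_le_iff₀ hA] at h1
  have hp := norm_nonneg (∑ j, a j • e j)
  set p := ‖∑ j, a j • e j‖
  set q := ‖∑ j, a j • s j‖
  have hq : 0 ≤ q := norm_nonneg _
  have hup : q ≤ (1 + η) * p := h2.trans (by gcongr)
  have hlow : p ≤ (1 + η) * q := h1.trans (by gcongr)
  have hηp : η * p ≤ η * k := by gcongr
  rw [abs_le]
  constructor
  · rcases le_total q p with hqp | hqp <;> nlinarith
  · linarith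

theorem exists_seqEquivTo_of_dist_coeffNorm {k : ℕ} {e : Fin k → E} (he : LinearIndependent ℝ e)
    {ε : ℝ} (hε : 0 < ε) :
    ∃ δ > 0, ∀ s : Fin k → X,
      dist (coeffNorm s) (coeffNorm e) < δ → SeqEquivTo (1 + ε) s e := by
  obtain ⟨K, hK, hanti⟩ := (Fintype.linearCombination ℝ e).exists_antilipschitzWith
    (LinearMap.ker_eq_bot.2 (linearIndependent_iff_injective_fintypeLinearCombination.1 he))
  have hKpos : (0 : ℝ) < K := hK
  have hnorm : ∀ a : Fin k → ℝ, ‖a‖ ≤ K * ‖∑ j, a j • e j‖ := fun a => by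
    simpa [Fintype.linearCombination_apply] using hanti.le_mul_dist a 0
  refine ⟨ε / (2 + ε) / K, by positivity, fun s hs =>
    ⟨(2 + ε) / 2, (2 + 2 * ε) / (2 + ε), by positivity, by positivity,
      le_of_eq (by field_simp), fun a => ?_⟩⟩
  have h : |‖∑ j, a j • s j‖ - ‖∑ j, a j • e j‖| ≤ ε / (2 + ε) * ‖∑ j, a j • e j‖ :=
    calc |‖∑ j, a j • s j‖ - ‖∑ j, a j • e j‖|
        ≤ dist (coeffNorm s) (coeffNorm e) * ‖a‖ := abs_norm_sum_sub_le_dist_coeffNorm s e a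
      _ ≤ ε / (2 + ε) / K * (K * ‖∑ j, a j • e j‖) := by gcongr; exact hnorm a
      _ = ε / (2 + ε) * ‖∑ j, a j • e j‖ := by field_simp
  obtain ⟨h1, h2⟩ := abs_le.1 h
  have e1 : 1 / ((2 + ε) / 2) = 1 - ε / (2 + ε) := by field_simp; ring
  have e2 : (2 + 2 * ε) / (2 + ε) = 1 + ε / (2 + ε) := by field_simp; ring
  rw [e1, e2]
  constructor <;> linarith

theorem InAsymStruct.gameWin {k : ℕ} {e : Fin k → E} (he : ∀ j, ‖e j‖ = 1)
    (h : InAsymStruct X e) {ε : ℝ} (hε : 0 < ε) :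
    GameWin (finCodimSpheres X) k fun s => dist (coeffNorm s) (coeffNorm e) < ε := by
  obtain ⟨x, hcausal, hx⟩ := h (ε / (k + 1)) (by positivity)
  refine gameWin_of_strategy x hcausal fun Y hY => ⟨(hx Y hY).1, ?_⟩
  refine ((hx Y hY).2.dist_coeffNorm_le (fun j => ((hx Y hY).1 j).2) he
    (by positivity)).trans_lt ?_
  rw [div_mul_eq_mul_div, div_lt_iff₀ (by positivity)]
  linarith

theorem inAsymStruct_of_gameWin {k : ℕ} {e : Fin k → E} (he : LinearIndependent ℝ e)
    (h : ∀ ε : ℝ, 0 < ε →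
      GameWin (finCodimSpheres X) k fun s => dist (coeffNorm s) (coeffNorm e) < ε) :
    InAsymStruct X e := by
  intro ε hε
  obtain ⟨δ, hδ, hequiv⟩ := exists_seqEquivTo_of_dist_coeffNorm (X := X) he hε
  obtain ⟨x, hcausal, hx⟩ := exists_strategy_of_gameWin (h δ hδ)
  exact ⟨x, hcausal, fun Y hY => ⟨(hx Y hY).1, hequiv _ (hx Y hY).2⟩⟩

theorem FinCodimClosed.comap_subtype {W : Submodule ℝ X} (hW : FinCodimClosed W)
    (Y : Submodule ℝ X) : FinCodimClosed (W.comap Y.subtype) := by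
  refine ⟨hW.1.preimage continuous_subtype_val, ?_⟩
  have := hW.2
  refine FiniteDimensional.of_injective ((W.comap Y.subtype).mapQ W Y.subtype le_rfl) ?_
  rw [← LinearMap.ker_eq_bot, Submodule.ker_mapQ]
  simp

theorem InAsymStruct.of_subspace {Y : Submodule ℝ X} {k : ℕ} {e : Fin k → E}
    (h : InAsymStruct Y e) : InAsymStruct X e := by
  intro ε hε
  obtain ⟨x, hcausal, hx⟩ := h ε hε
  refine ⟨fun W l => x (fun j => (W j).comap Y.subtype) l, fun W W' l hl => ?_, fun W hW => ?_⟩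
  · exact congrArg _ (hcausal _ _ _ fun j hj => by rw [hl j hj])
  · obtain ⟨hmem, A, B, hA, hB, hAB, hequiv⟩ := hx _ fun j => (hW j).comap_subtype Y
    refine ⟨fun l => ⟨(hmem l).1, (hmem l).2⟩, A, B, hA, hB, hAB, fun a => ?_⟩
    rw [norm_sum_smul_coe]
    exact hequiv a

theorem exists_countable_approximating (X : Type*) [NormedAddCommGroup X] [NormedSpace ℝ X] :
    ∃ D : Set X, D.Countable ∧ ∀ (k : ℕ) (g : C(Metric.closedBall (0 : Fin k → ℝ) 1, ℝ)) (ε : ℝ),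
      0 < ε → (∀ η > 0, GameWin (finCodimSpheres X) k fun s => dist (coeffNorm s) g < η) →
        GameWin (weakNhdSpheres D) k fun s => dist (coeffNorm s) g < ε := by
  let q (k : ℕ) := TopologicalSpace.denseSeq C(Metric.closedBall (0 : Fin k → ℝ) 1, ℝ)
  have key : ∀ i : ℕ × ℕ × ℕ, ∃ D : Set X, D.Countable ∧
      ((GameWin (finCodimSpheres X) i.1
        fun s => dist (coeffNorm s) (q i.1 i.2.1) < 1 / ((i.2.2 : ℝ) + 1)) →
      GameWin (weakNhdSpheres D) i.1
        fun s => dist (coeffNorm s) (q i.1 i.2.1) < 1 / ((i.2.2 : ℝ) + 1)) := fun i => by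
    by_cases h : GameWin (finCodimSpheres X) i.1
        fun s => dist (coeffNorm s) (q i.1 i.2.1) < 1 / ((i.2.2 : ℝ) + 1)
    · obtain ⟨D, hD, hw⟩ := exists_countable_gameWin h
      exact ⟨D, hD, fun _ => hw⟩
    · exact ⟨∅, Set.countable_empty, fun h' => absurd h' h⟩
  choose D hD hw using key
  refine ⟨⋃ i, D i, Set.countable_iUnion hD, fun k g ε hε hg => ?_⟩
  obtain ⟨n, hn⟩ := exists_nat_one_div_lt (half_pos hε)
  have hn0 : (0 : ℝ) < 1 / ((n : ℝ) + 1) := by positivity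
  obtain ⟨i, hi⟩ := (TopologicalSpace.denseRange_denseSeq
    C(Metric.closedBall (0 : Fin k → ℝ) 1, ℝ)).exists_dist_lt g (half_pos hn0)
  have hwin := hw (k, i, n) ((hg _ (half_pos hn0)).mono (fun A hA => ⟨A, hA, subset_rfl⟩)
    fun s hs => (dist_triangle _ g _).trans_lt (by linarith))
  refine (gameWin_weakNhdSpheres_mono (Set.subset_iUnion D _) hwin).mono
    (fun A hA => ⟨A, hA, subset_rfl⟩) fun s hs => ?_
  refine (dist_triangle _ (q k i) _).trans_lt ?_
  rw [dist_comm (q k i) g]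
  linarith

end AsymptoticGame

/-- every reflexive Banach space `X` has a separable closed subspace `Y` with
the same asymptotic structure: `{X}_k = {Y}_k` for every `k`. -/
theorem statement_10 {X : Type*} [NormedAddCommGroup X] [NormedSpace ℝ X] [CompleteSpace X]
    (hX : IsReflexiveSpace X) :
    ∃ Y : Submodule ℝ X, IsClosed (Y : Set X) ∧ TopologicalSpace.IsSeparable (Y : Set X) ∧
      ∀ (k : ℕ) (E : Type*) [NormedAddCommGroup E] [NormedSpace ℝ E] (e : Fin k → E),
        IsNormalizedMonotoneBasis e → (InAsymStruct X e ↔ InAsymStruct Y e) := by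
  obtain ⟨D, hD, hw⟩ := exists_countable_approximating X
  refine ⟨(Submodule.span ℝ D).topologicalClosure, Submodule.isClosed_topologicalClosure _,
    ?_, fun k E _ _ e he => ⟨fun h => ?_, InAsymStruct.of_subspace⟩⟩
  · rw [Submodule.topologicalClosure_coe]
    exact hD.isSeparable.span.closure
  · refine inAsymStruct_of_gameWin he.1 fun ε hε => ?_
    have hδ : 0 < ε / 2 / (k + 1) := by positivity
    refine (gameWin_subspace_of_weakNhdSpheres
      (Submodule.subset_span.trans (Submodule.le_topologicalClosure _)) hδ
      (hw k (coeffNorm e) (ε / 2) (by positivity) fun η hη => h.gameWin he.2.2.1 hη)).mono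
      (fun A hA => ⟨A, hA, subset_rfl⟩) ?_
    rintro t ⟨s, hs, hst⟩
    have h1 := dist_coeffNorm_le_of_norm_sub_le hδ.le hst
    rw [coeffNorm_subspace, dist_comm] at h1
    have h2 : k * (ε / 2 / (k + 1)) ≤ ε / 2 := by
      rw [mul_div_assoc', div_le_iff₀ (by positivity)]
      nlinarith
    exact (dist_triangle _ (coeffNorm s) _).trans_lt (by linarith)
end
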